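/- Fix real parameters M>0, l>0, a with |a|<l, and α<9/4, let E ∈ (1/l², V_max), and let δ>0 be such that [E−δ, E+δ] ⊂ (1/l², V_max). Then there exists H₀ > 0 such that for every h ∈ (0, H₀] there exist κ ∈ [E−δ, E+δ] and a nonzero twice continuously differentiable function u : [x_max, π/2) → ℝ satisfying −h²·u″(x) + (V_σ(R(x)) + h²·(V_junk(R(x)) + V_mass(R(x))))·u(x) = κ·u(x) for all x ∈ (x_max, π/2), with u(x_max) = 0 and ∫_{x_max}^{π/2} (|u′(x)|² + R(x)²·u(x)²) dx < ∞. -/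

import Mathlib

open Real MeasureTheory Set Filter Topology

/-- Δ₋(r) = (1+r²/l²)(r²+a²) − 2Mr -/
noncomputable def Dm (M l a r : ℝ) : ℝ := (1 + r^2/l^2)*(r^2+a^2) - 2*M*r

/-- V_σ(r) = Δ₋(r)/(r²+a²)² -/
noncomputable def Vsig (M l a r : ℝ) : ℝ := Dm M l a r / (r^2+a^2)^2

/-- Θ(α) = 1 if α>0, 0 if α≤0 -/
noncomputable def Th (α : ℝ) : ℝ := if 0 < α then 1 else 0

/-- V_junk -/
noncomputable def Vjunk (M l a α r : ℝ) : ℝ :=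
  -(3*r^2*(Dm M l a r)^2/(r^2+a^2)^4)
  + Dm M l a r * (5*r^4/l^2 + 3*r^2*(1+a^2/l^2) - 4*M*r + a^2)/(r^2+a^2)^3
  - (2/l^2) * (Dm M l a r * r^2/(r^2+a^2)^2)
  - (α/l^2) * (Dm M l a r /(r^2+a^2)^2) * Th α * a^2

/-- V_mass -/
noncomputable def Vmass (M l a α r : ℝ) : ℝ :=
  ((2-α)/l^2) * (Dm M l a r * r^2/(r^2+a^2)^2)

/-- The full potential in the tortoise coordinate, with semiclassical parameter h. -/
noncomputable def Vfull (M l a α : ℝ) (R : ℝ → ℝ) (h x : ℝ) : ℝ :=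
  Vsig M l a (R x) + h^2 * (Vjunk M l a α (R x) + Vmass M l a α (R x))

/-- κ is an eigenvalue of the Dirichlet problem P_DD(h). -/
def IsDirichletEigenvalue (M l a α : ℝ) (R : ℝ → ℝ) (xmax h κ : ℝ) : Prop :=
  ∃ u : ℝ → ℝ,
    (∃ x ∈ Set.Ico xmax (π/2), u x ≠ 0) ∧
    ContDiffOn ℝ 2 u (Set.Ico xmax (π/2)) ∧
    (∀ x ∈ Set.Ioo xmax (π/2),
      -h^2 * deriv (deriv u) x + Vfull M l a α R h x * u x = κ * u x) ∧
    u xmax = 0 ∧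
    MeasureTheory.IntegrableOn (fun x => (deriv u x)^2 + (R x)^2 * (u x)^2)
      (Set.Ioo xmax (π/2))


theorem compact_sa_quasimode {L : Type*} [NormedAddCommGroup L] [InnerProductSpace ℝ L]
    [CompleteSpace L] (T : L →L[ℝ] L) (hc : IsCompactOperator T)
    (hs : ∀ x y, inner ℝ (T x) y = inner ℝ x (T y)) (F : L) (lam δ : ℝ)
    (hq : ‖F - lam • T F‖ < δ * ‖T F‖) :
    ∃ (m : ℝ) (e : L), m ≠ 0 ∧ e ≠ 0 ∧ T e = m • e ∧ |1 / m - lam| ≤ δ := by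
  by_contra hcon
  push Not at hcon
  have hδ : 0 < δ := by
    by_contra h
    have := norm_nonneg (F - lam • T F)
    nlinarith [norm_nonneg (T F)]
  have hsym : T.IsSymmetric := fun x y => hs x y
  have hort := ContinuousLinearMap.orthogonalComplement_iSup_eigenspaces_eq_bot hc hsym
  have hV : IsHilbertSum ℝ (fun m : ℝ => Module.End.eigenspace (T : Module.End ℝ L) m)
      fun m => (Module.End.eigenspace (T : Module.End ℝ L) m).subtypeₗᵢ := by
    have : ∀ m : ℝ, CompleteSpace (Module.End.eigenspace (T : Module.End ℝ L) m) := by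
      intro m
      have : IsClosed ((Module.End.eigenspace (T : Module.End ℝ L) m : Submodule ℝ L) : Set L) := by
        have : ((Module.End.eigenspace (T : Module.End ℝ L) m : Submodule ℝ L) : Set L)
            = {x | T x = m • x} := by
          ext x; simp 
        rw [this]
        exact isClosed_eq T.continuous (continuous_const_smul m)
      exact this.completeSpace_coe
    refine IsHilbertSum.mkInternal _ hsym.orthogonalFamily_eigenspaces ?_
    rw [top_le_iff, Submodule.topologicalClosure_eq_top_iff]
    exact hort
  set U := hV.linearIsometryEquiv with hU
  have key : ∀ (x : L) (m : ℝ) (e : Module.End.eigenspace (T : Module.End ℝ L) m),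
      inner ℝ (e : L) x = inner ℝ e (U x m) := by
    classical
    intro x m e
    have h1 : U.symm (lp.single 2 m e) = (e : L) := by
      rw [hU, hV.linearIsometryEquiv_symm_apply_single]; rfl
    rw [← h1, ← lp.inner_single_left m e (U x), ← U.inner_map_map (U.symm _) x]
    simp
  have hTe : ∀ (m : ℝ) (e : Module.End.eigenspace (T : Module.End ℝ L) m),
      T (e : L) = m • (e : L) := fun m e => Module.End.mem_eigenspace_iff.1 e.2
  have hc2 : ∀ m, U (T F) m = m • U F m := by
    intro m
    refine ext_inner_left ℝ fun e => ?_
    rw [← key, inner_smul_right, ← key, ← hs, hTe, inner_smul_left]; simp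
  have hle : ∀ m, δ * ‖U (T F) m‖ ≤ ‖U (F - lam • T F) m‖ := by
    intro m
    have h1 : U (F - lam • T F) m = U F m - lam • U (T F) m := by
      rw [map_sub, map_smul]; rfl
    rw [h1, hc2]
    by_cases hm : m = 0
    · simp [hm]
    by_cases he : U F m = 0
    · simp [he]
    have h3 := hcon m (U F m : L) hm (by simpa using he) (hTe m _)
    have h4 : U F m - lam • m • U F m = ((1 / m - lam) * m) • U F m := by
      rw [sub_mul, sub_smul, smul_smul]; field_simp; simp
    rw [h4, norm_smul, norm_smul, norm_mul, ← mul_assoc]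
    simp only [Real.norm_eq_abs]
    gcongr
  have hn : ∀ x : L, HasSum (fun m => ‖U x m‖ ^ 2) (‖x‖ ^ 2) := by
    intro x
    have := lp.hasSum_inner (𝕜 := ℝ) (U x) (U x)
    simpa [real_inner_self_eq_norm_sq] using this
  have h5 := hasSum_le (fun m => by
    have := hle m
    show δ ^ 2 * ‖U (T F) m‖ ^ 2 ≤ _
    rw [← mul_pow]
    exact pow_le_pow_left₀ (by positivity) this 2) ((hn (T F)).mul_left (δ ^ 2))
      (hn (F - lam • T F))
  rw [← mul_pow] at h5
  exact absurd (pow_lt_pow_left₀ hq (norm_nonneg _) two_ne_zero) (not_lt.2 h5)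

theorem abstract_eig {H L : Type*} [NormedAddCommGroup H] [InnerProductSpace ℝ H]
    [CompleteSpace H] [NormedAddCommGroup L] [InnerProductSpace ℝ L] [CompleteSpace L]
    (B : H →L[ℝ] H →L[ℝ] ℝ) (hB : IsCoercive B) (hsymm : ∀ x y, B x y = B y x)
    (J : H →L[ℝ] L) (hJ : IsCompactOperator J) (g0 : H) (F : L)
    (hg0 : ∀ φ, B g0 φ = inner ℝ F (J φ)) (lam δ : ℝ)
    (hq : ‖F - lam • J g0‖ < δ * ‖J g0‖) :
    ∃ (g : H) (κ : ℝ), |κ - lam| ≤ δ ∧ J g ≠ 0 ∧ ∀ φ, B g φ = κ * inner ℝ (J g) (J φ) := by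
  set A := hB.continuousLinearEquivOfBilin with hA
  have hAB : ∀ v w, inner ℝ (A v) w = B v w := hB.continuousLinearEquivOfBilin_apply
  let S : L →L[ℝ] H := (A.symm : H →L[ℝ] H) ∘L (ContinuousLinearMap.adjoint J)
  have hS : ∀ x φ, B (S x) φ = inner ℝ x (J φ) := by
    intro x φ
    rw [← hAB]
    simp [S, ContinuousLinearMap.adjoint_inner_left]
  let T : L →L[ℝ] L := J ∘L S
  have hT : IsCompactOperator T := hJ.comp_clm S
  have hs : ∀ x y, inner ℝ (T x) y = inner ℝ x (T y) := by
    intro x y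
    show inner ℝ (J (S x)) y = inner ℝ x (J (S y))
    rw [← hS, real_inner_comm, ← hS, hsymm]
  have hSF : S F = g0 := by
    have : A (S F) = A g0 := by
      refine ext_inner_right ℝ fun φ => ?_
      rw [hAB, hAB, hS, hg0]
    exact A.injective this
  have hTF : T F = J g0 := by show J (S F) = _; rw [hSF]
  obtain ⟨m, e, hm, he, hTe, hd⟩ := compact_sa_quasimode T hT hs F lam δ (by rw [hTF]; exact hq)
  refine ⟨S e, 1 / m, hd, ?_, ?_⟩
  · have : J (S e) = m • e := hTe
    rw [this]; simp [hm, he]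
  · intro φ
    have : J (S e) = m • e := hTe
    rw [hS, this, inner_smul_left]; simp; field_simp

/-- primitive vanishing at `b` -/
noncomputable def prim (b : ℝ) (g : ℝ → ℝ) (x : ℝ) : ℝ := ∫ t in b..x, g t

/-- Lebesgue measure on `(p,b]` -/
noncomputable def mu (p b : ℝ) : Measure ℝ := volume.restrict (Ioc p b)

instance mu_fin (p b : ℝ) : IsFiniteMeasure (mu p b) := by unfold mu; infer_instance

theorem L2_norm_sq {p b : ℝ} (f : Lp ℝ 2 (mu p b)) : ‖f‖ ^ 2 = ∫ x, (f x) ^ 2 ∂(mu p b) := by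
  rw [← real_inner_self_eq_norm_sq, L2.inner_def]
  simp [pow_two]

theorem memLp_intervalIntegrable {p b : ℝ} (hpb : p ≤ b) {g : ℝ → ℝ} (hg : MemLp g 2 (mu p b)) :
    IntervalIntegrable g volume p b := by
  rw [intervalIntegrable_iff_integrableOn_Ioc_of_le hpb]
  exact hg.integrable (by norm_num)

theorem ii_sub {p b : ℝ} {g : ℝ → ℝ} (hg : IntervalIntegrable g volume p b)
    {x y : ℝ} (hx : x ∈ Icc p b) (hy : y ∈ Icc p b) : IntervalIntegrable g volume x y := by
  refine hg.mono_set ?_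
  rw [uIcc_of_le (hx.1.trans hx.2)]
  exact uIcc_subset_Icc hx hy

theorem prim_ac {p b : ℝ} (hpb : p ≤ b) {g : ℝ → ℝ} (hg : MemLp g 2 (mu p b)) :
    AbsolutelyContinuousOnInterval (prim b g) p b :=
  (memLp_intervalIntegrable hpb hg).absolutelyContinuousOnInterval_intervalIntegral (by simp)

theorem prim_cont {p b : ℝ} (hpb : p ≤ b) {g : ℝ → ℝ} (hg : MemLp g 2 (mu p b)) :
    ContinuousOn (prim b g) (Icc p b) := by
  have := (prim_ac hpb hg).continuousOn
  rwa [uIcc_of_le hpb] at this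

theorem prim_deriv {p b : ℝ} (hpb : p ≤ b) {g : ℝ → ℝ} (hg : MemLp g 2 (mu p b)) :
    ∀ᵐ x, x ∈ Icc p b → HasDerivAt (prim b g) (g x) x := by
  filter_upwards [(memLp_intervalIntegrable hpb hg).ae_hasDerivAt_integral] with x hx hx2
  rw [uIcc_of_le hpb] at hx
  exact hx hx2 b (by simp [hpb])

theorem prim_diff {p b : ℝ} (hpb : p ≤ b) {g : ℝ → ℝ} (hg : MemLp g 2 (mu p b))
    {x y : ℝ} (hx : x ∈ Icc p b) (hy : y ∈ Icc p b) :
    prim b g y - prim b g x = ∫ t in x..y, g t := by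
  have h := memLp_intervalIntegrable hpb hg
  have hb : b ∈ Icc p b := by simp [hpb]
  unfold prim
  rw [intervalIntegral.integral_interval_sub_left (ii_sub h hb hy) (ii_sub h hb hx)]

theorem cs_interval {p b : ℝ} {g : ℝ → ℝ} (hg : MemLp g 2 (mu p b))
    {x y : ℝ} (hxy : x ≤ y) (hx : p ≤ x) (hy : y ≤ b) :
    (∫ t in x..y, g t) ^ 2 ≤ (y - x) * ∫ t in Ioc x y, (g t) ^ 2 := by
  have hsub : Ioc x y ⊆ Ioc p b := Ioc_subset_Ioc hx hy
  have hg' : MemLp g 2 (volume.restrict (Ioc x y)) := by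
    have := hg.restrict (Ioc x y)
    rwa [mu, Measure.restrict_restrict measurableSet_Ioc, inter_eq_left.2 hsub] at this
  have hi1 : Integrable g (volume.restrict (Ioc x y)) := hg'.integrable (by norm_num)
  have hi2 : Integrable (fun t => g t ^ 2) (volume.restrict (Ioc x y)) := hg'.integrable_sq
  rw [intervalIntegral.integral_of_le hxy]
  set I1 := ∫ t in Ioc x y, g t with hI
  set Q := ∫ t in Ioc x y, g t ^ 2 with hQ
  have hc : ∫ t in Ioc x y, (1:ℝ) = y - x := by simp [hxy]
  have h0 : 0 ≤ ∫ t in Ioc x y, ((y - x) * g t - I1) ^ 2 := integral_nonneg fun t => sq_nonneg _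
  have h1 : ∫ t in Ioc x y, ((y - x) * g t - I1) ^ 2 = (y-x)^2 * Q - 2 * (y-x) * I1 * I1 + I1^2*(y-x) := by
    have : (fun t => ((y - x) * g t - I1) ^ 2) = fun t => (y-x)^2 * g t ^ 2 - (2 * (y-x) * I1) * g t + I1^2 * 1 := by
      ext t; ring
    rw [this, integral_add, integral_sub, integral_const_mul, integral_const_mul,
      integral_const_mul, hc]
    · exact hi2.const_mul _
    · exact hi1.const_mul _
    · exact (hi2.const_mul _).sub (hi1.const_mul _)
    · exact (integrable_const _)
  rw [h1] at h0
  rcases hxy.eq_or_lt with rfl | hlt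
  · simp [hI]
  · have : 0 ≤ (y - x) * ((y-x) * Q - I1^2) := by nlinarith
    have := nonneg_of_mul_nonneg_right this (by linarith)
    linarith

theorem int_sub_le {p b : ℝ} {g : ℝ → ℝ} (hg : MemLp g 2 (mu p b))
    {x y : ℝ} (hx : p ≤ x) (hy : y ≤ b) :
    ∫ t in Ioc x y, (g t) ^ 2 ≤ ∫ t, (g t)^2 ∂(mu p b) := by
  have hsub : Ioc x y ⊆ Ioc p b := Ioc_subset_Ioc hx hy
  exact setIntegral_mono_set hg.integrable_sq (ae_of_all _ fun t => sq_nonneg _)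
    (LE.le.eventuallyLE hsub)

theorem prim_holder {p b : ℝ} (hpb : p ≤ b) {g : ℝ → ℝ} (hg : MemLp g 2 (mu p b))
    {x y : ℝ} (hxy : x ≤ y) (hx : p ≤ x) (hy : y ≤ b) :
    (prim b g y - prim b g x) ^ 2 ≤ (y - x) * ∫ t, (g t)^2 ∂(mu p b) := by
  rw [prim_diff hpb hg ⟨hx, hxy.trans hy⟩ ⟨hx.trans hxy, hy⟩]
  exact (cs_interval hg hxy hx hy).trans
    (mul_le_mul_of_nonneg_left (int_sub_le hg hx hy) (by linarith))

theorem prim_b (b : ℝ) (g : ℝ → ℝ) : prim b g b = 0 := by simp [prim]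

theorem prim_bound {p b : ℝ} (hpb : p ≤ b) {g : ℝ → ℝ} (hg : MemLp g 2 (mu p b))
    {x : ℝ} (hx : x ∈ Icc p b) :
    (prim b g x) ^ 2 ≤ (b - x) * ∫ t in Ioc x b, (g t)^2 := by
  have := cs_interval hg hx.2 hx.1 le_rfl
  rw [← prim_diff hpb hg hx ⟨hpb, le_rfl⟩, prim_b] at this
  simpa using this

theorem prim_congr {p b : ℝ} {g g' : ℝ → ℝ} (h : g =ᵐ[mu p b] g')
    {x : ℝ} (hx : x ∈ Icc p b) : prim b g x = prim b g' x := by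
  unfold prim
  refine intervalIntegral.integral_congr_ae ?_
  rw [uIoc_of_ge hx.2]
  have := (ae_restrict_iff' measurableSet_Ioc).1 h
  filter_upwards [this] with t ht ht2
  exact ht ⟨hx.1.trans_lt ht2.1, ht2.2⟩

/-- integration by parts against a primitive -/
theorem ibp {p b : ℝ} (hpb : p ≤ b) {g : ℝ → ℝ} (hg : MemLp g 2 (mu p b)) {y : ℝ} (hpy : p ≤ y)
    (hy : y ≤ b) {f : ℝ → ℝ} (hf : AbsolutelyContinuousOnInterval f p y) {f' : ℝ → ℝ}
    (hf' : ∀ᵐ x, x ∈ Icc p y → HasDerivAt f (f' x) x) :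
    ∫ x in p..y, f x * g x = f y * prim b g y - f p * prim b g p
      - ∫ x in p..y, f' x * prim b g x := by
  have hac : AbsolutelyContinuousOnInterval (prim b g) p y :=
    (prim_ac hpb hg).mono (by
      rw [uIcc_of_le hpy, uIcc_of_le hpb]; exact Icc_subset_Icc le_rfl hy)
  have h := hf.integral_mul_deriv_eq_deriv_mul hac
  rw [intervalIntegral.integral_congr_ae (g := fun x => f x * g x),
    intervalIntegral.integral_congr_ae (f := fun x => deriv f x * prim b g x)
      (g := fun x => f' x * prim b g x)] at h
  · exact h
  · filter_upwards [hf'] with x hx hx2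
    rw [uIoc_of_le hpy] at hx2
    rw [(hx ⟨hx2.1.le, hx2.2⟩).deriv]
  · filter_upwards [prim_deriv hpb hg] with x hx hx2
    rw [uIoc_of_le hpy] at hx2
    rw [(hx ⟨hx2.1.le, hx2.2.trans hy⟩).deriv]

theorem prim_add {p b : ℝ} (hpb : p ≤ b) (f g : Lp ℝ 2 (mu p b)) {x : ℝ} (hx : x ∈ Icc p b) :
    prim b (f + g : Lp ℝ 2 (mu p b)) x = prim b f x + prim b g x := by
  rw [prim_congr (Lp.coeFn_add f g) hx]
  have hb : b ∈ Icc p b := by simp [hpb]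
  exact intervalIntegral.integral_add
    (ii_sub (memLp_intervalIntegrable hpb (Lp.memLp f)) hb hx)
    (ii_sub (memLp_intervalIntegrable hpb (Lp.memLp g)) hb hx)

theorem prim_smul {p b : ℝ} (c : ℝ) (f : Lp ℝ 2 (mu p b)) {x : ℝ} (hx : x ∈ Icc p b) :
    prim b (c • f : Lp ℝ 2 (mu p b)) x = c * prim b f x := by
  rw [prim_congr (Lp.coeFn_smul c f) hx]
  simp [prim]

theorem ae_mem (p b : ℝ) : ∀ᵐ x ∂(mu p b), x ∈ Ioc p b := ae_restrict_mem measurableSet_Ioc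

theorem prim_aesm {p b : ℝ} (hpb : p ≤ b) {g : ℝ → ℝ} (hg : MemLp g 2 (mu p b)) :
    AEStronglyMeasurable (prim b g) (mu p b) :=
  ((prim_cont hpb hg).mono Ioc_subset_Icc_self).aestronglyMeasurable measurableSet_Ioc

theorem exists_mulPrim {p b : ℝ} (hpb : p ≤ b) (w : ℝ → ℝ)
    (hw : AEStronglyMeasurable w (mu p b)) (C : ℝ) (hC0 : 0 ≤ C)
    (hC : ∀ g, MemLp g 2 (mu p b) → Integrable (fun x => (w x * prim b g x)^2) (mu p b) ∧
      ∫ x, (w x * prim b g x)^2 ∂(mu p b) ≤ C^2 * ∫ x, (g x)^2 ∂(mu p b)) :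
    ∃ D : Lp ℝ 2 (mu p b) →L[ℝ] Lp ℝ 2 (mu p b),
      ∀ g : Lp ℝ 2 (mu p b), D g =ᵐ[mu p b] fun x => w x * prim b g x := by
  have hm : ∀ g : Lp ℝ 2 (mu p b), MemLp (fun x => w x * prim b g x) 2 (mu p b) := by
    intro g
    exact (memLp_two_iff_integrable_sq (hw.mul (prim_aesm hpb (Lp.memLp g)))).2
      (hC g (Lp.memLp g)).1
  let D0 : Lp ℝ 2 (mu p b) →ₗ[ℝ] Lp ℝ 2 (mu p b) :=
    { toFun := fun g => (hm g).toLp _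
      map_add' := by
        intro f g
        rw [← MemLp.toLp_add, MemLp.toLp_eq_toLp_iff]
        filter_upwards [ae_mem p b] with x hx
        simp only [Pi.add_apply]
        rw [prim_add hpb f g (Ioc_subset_Icc_self hx)]; ring
      map_smul' := by
        intro c f
        simp only [RingHom.id_apply]
        rw [← MemLp.toLp_const_smul, MemLp.toLp_eq_toLp_iff]
        filter_upwards [ae_mem p b] with x hx
        simp only [Pi.smul_apply, smul_eq_mul]
        rw [prim_smul c f (Ioc_subset_Icc_self hx)]; ring }
  refine ⟨D0.mkContinuous C ?_, fun g => ?_⟩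
  · intro g
    have h1 : ‖D0 g‖ ^ 2 ≤ (C * ‖g‖) ^ 2 := by
      rw [mul_pow, L2_norm_sq, L2_norm_sq]
      refine le_trans (le_of_eq ?_) (hC g (Lp.memLp g)).2
      refine integral_congr_ae ?_
      filter_upwards [(hm g).coeFn_toLp] with x hx
      show ((hm g).toLp _ : ℝ → ℝ) x ^ 2 = _
      rw [hx]
    exact le_of_sq_le_sq h1 (by positivity)
  · exact (hm g).coeFn_toLp

theorem Lp_coeFn_sum {p b : ℝ} (s : Finset ℕ) (f : ℕ → Lp ℝ 2 (mu p b)) :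
    ∀ᵐ x ∂(mu p b), (∑ i ∈ s, f i : Lp ℝ 2 (mu p b)) x = ∑ i ∈ s, f i x := by
  classical
  induction s using Finset.induction_on with
  | empty =>
    filter_upwards [Lp.coeFn_zero ℝ 2 (mu p b)] with x hx
    simpa using hx
  | insert i s hi ih =>
    rw [Finset.sum_insert hi]
    filter_upwards [ih, Lp.coeFn_add (f i) (∑ i ∈ s, f i)] with x h1 h2
    rw [h2, Pi.add_apply, h1, Finset.sum_insert hi]

theorem prim_one_bound {p b : ℝ} (hpb : p ≤ b) (g : ℝ → ℝ) (hg : MemLp g 2 (mu p b)) :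
    Integrable (fun x => ((1:ℝ) * prim b g x)^2) (mu p b) ∧
      ∫ x, ((1:ℝ) * prim b g x)^2 ∂(mu p b) ≤ (b - p)^2 * ∫ x, (g x)^2 ∂(mu p b) := by
  have h1 : Integrable (fun x => ((1:ℝ) * prim b g x)^2) (mu p b) := by
    simp only [one_mul]
    have : ContinuousOn (fun x => prim b g x ^ 2) (Icc p b) := (prim_cont hpb hg).pow 2
    exact (this.integrableOn_Icc).mono_set Ioc_subset_Icc_self
  refine ⟨h1, ?_⟩
  have h2 : ∫ x, ((1:ℝ) * prim b g x)^2 ∂(mu p b) ≤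
      ∫ x, (b - p) * ∫ x, (g x)^2 ∂(mu p b) ∂(mu p b) := by
    refine integral_mono_ae h1 (integrable_const _) ?_
    filter_upwards [ae_mem p b] with x hx
    rw [one_mul]
    refine (prim_bound hpb hg (Ioc_subset_Icc_self hx)).trans ?_
    refine mul_le_mul (by linarith [hx.1]) (int_sub_le hg hx.1.le le_rfl)
      (integral_nonneg fun t => sq_nonneg _) (by linarith)
  refine h2.trans (le_of_eq ?_)
  rw [integral_const]
  simp [mu, hpb]; ring

theorem K_compact {p b : ℝ} (hpb : p < b) (K : Lp ℝ 2 (mu p b) →L[ℝ] Lp ℝ 2 (mu p b))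
    (hK : ∀ g : Lp ℝ 2 (mu p b), K g =ᵐ[mu p b] fun x => prim b g x) : IsCompactOperator K := by
  have hd : 0 < b - p := by linarith
  let X : ℕ → ℕ → ℝ := fun n i => p + (b - p) * i / (n + 1)
  let e : ℕ → ℕ → Lp ℝ 2 (mu p b) := fun n i =>
    indicatorConstLp 2 (s := Ioc (X n i) b) measurableSet_Ioc (measure_ne_top _ _) (1:ℝ)
  let f : ℕ → ℕ → Lp ℝ 2 (mu p b) := fun n i =>
    indicatorConstLp 2 (s := Ioc (X n i) (X n (i+1))) measurableSet_Ioc (measure_ne_top _ _) (1:ℝ)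
  let Kn : ℕ → (Lp ℝ 2 (mu p b) →L[ℝ] Lp ℝ 2 (mu p b)) := fun n =>
    ∑ i ∈ Finset.range (n+1), - (innerSL ℝ (e n i)).smulRight (f n i)
  have hXmem : ∀ n i, i ≤ n + 1 → X n i ∈ Icc p b := by
    intro n i hi
    have hi' : (i:ℝ) ≤ n + 1 := by exact_mod_cast hi
    have : (i:ℝ) / (n+1) ≤ 1 := by rw [div_le_one (by positivity)]; exact hi'
    have h0 : 0 ≤ (i:ℝ) / (n+1) := by positivity
    simp only [X, mul_div_assoc]
    constructor <;> nlinarith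
  have hin : ∀ n i, i ≤ n + 1 → ∀ g : Lp ℝ 2 (mu p b), - inner ℝ (e n i) g = prim b g (X n i) := by
    intro n i hi g
    have hX := hXmem n i hi
    simp only [e]
    rw [L2.inner_indicatorConstLp_one, prim, intervalIntegral.integral_symm,
      intervalIntegral.integral_of_le hX.2]
    congr 2
    rw [mu, Measure.restrict_restrict measurableSet_Ioc,
      inter_eq_left.2 (Ioc_subset_Ioc hX.1 le_rfl)]
  have hKn : ∀ n : ℕ, ∀ g : Lp ℝ 2 (mu p b), ∀ᵐ x ∂(mu p b), ∃ y ∈ Icc p b, y ≤ x ∧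
      x - y ≤ (b - p) / (n + 1) ∧ Kn n g x = prim b g y := by
    intro n g
    have h1 : Kn n g =ᵐ[mu p b] fun x => ∑ i ∈ Finset.range (n+1),
        prim b g (X n i) * (Ioc (X n i) (X n (i+1))).indicator (fun _ => (1:ℝ)) x := by
      have : Kn n g = ∑ i ∈ Finset.range (n+1), prim b g (X n i) • f n i := by
        simp only [Kn, _root_.sum_apply, _root_.neg_apply,
          ContinuousLinearMap.smulRight_apply, innerSL_apply_apply]
        refine Finset.sum_congr rfl fun i hi => ?_
        rw [← hin n i (by have := Finset.mem_range.1 hi; omega), neg_smul]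
      rw [this]
      have h2 : ∀ᵐ x ∂(mu p b), ∀ i ∈ Finset.range (n+1), (prim b g (X n i) • f n i : Lp ℝ 2 (mu p b)) x =
          prim b g (X n i) * (Ioc (X n i) (X n (i+1))).indicator (fun _ => (1:ℝ)) x := by
        rw [Finset.eventually_all]
        intro i hi
        filter_upwards [Lp.coeFn_smul (prim b g (X n i)) (f n i),
          indicatorConstLp_coeFn (p := 2) (μ := mu p b) (hs := measurableSet_Ioc (a := X n i) (b := X n (i+1)))
            (hμs := measure_ne_top _ _) (c := (1:ℝ))] with x hx hx2
        rw [hx, Pi.smul_apply, smul_eq_mul, hx2]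
      filter_upwards [h2, Lp_coeFn_sum (Finset.range (n+1)) (fun i => prim b g (X n i) • f n i)] with x hx hx2
      rw [hx2]
      exact Finset.sum_congr rfl hx
    filter_upwards [h1, ae_mem p b] with x hx hxm
    have hn : (0:ℝ) < n + 1 := by positivity
    set z := (x - p) * (n + 1) / (b - p) with hz
    have hz0 : 0 < z := by
      have : 0 < x - p := by linarith [hxm.1]
      positivity
    have hz1 : z ≤ n + 1 := by
      rw [hz, div_le_iff₀ hd]; nlinarith [hxm.2]
    have hxz : x = p + (b - p) * z / (n + 1) := by
      rw [hz]; field_simp; ring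
    obtain ⟨j, hj⟩ : ∃ j, ⌈z⌉₊ = j + 1 := Nat.exists_eq_succ_of_ne_zero (by
      have := Nat.ceil_pos.2 hz0; omega)
    have hjz1 : (j:ℝ) < z := by
      have := Nat.ceil_lt_add_one hz0.le
      rw [hj] at this; push_cast at this; linarith
    have hjz2 : z ≤ j + 1 := by
      have := Nat.le_ceil z
      rw [hj] at this; exact_mod_cast this
    have hjn : j < n + 1 := by
      have : (j:ℝ) < (n:ℝ) + 1 := by linarith
      exact_mod_cast this
    have hmem : ∀ i : ℕ, x ∈ Ioc (X n i) (X n (i+1)) ↔ (i:ℝ) < z ∧ z ≤ i + 1 := by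
      intro i
      have hcd : 0 < (b - p) / (n+1) := by positivity
      have e1 : x = p + (b - p) / (n+1) * z := by rw [hxz]; ring_nf
      have e2 : X n i = p + (b-p)/(n+1) * i := by simp only [X]; ring
      have e3 : X n (i+1) = p + (b-p)/(n+1) * (i+1) := by simp only [X]; push_cast; ring
      rw [mem_Ioc, e2, e3]
      conv_lhs => rw [e1]
      rw [add_lt_add_iff_left, add_le_add_iff_left, mul_lt_mul_iff_right₀ hcd, mul_le_mul_iff_right₀ hcd]
    have hxj := (hmem j).2 ⟨hjz1, hjz2⟩
    refine ⟨X n j, hXmem n j (by omega), hxj.1.le, ?_, ?_⟩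
    · have : X n (j+1) = X n j + (b - p) / (n+1) := by simp only [X]; push_cast; ring
      linarith [hxj.2]
    · rw [hx, Finset.sum_eq_single j]
      · rw [indicator_of_mem hxj, mul_one]
      · intro i _ hij
        rw [indicator_of_notMem, mul_zero]
        rw [hmem]
        rintro ⟨h1, h2⟩
        apply hij
        have a1 : (i:ℝ) < j + 1 := by linarith
        have a2 : (j:ℝ) < i + 1 := by linarith
        norm_cast at a1 a2
        omega
      · intro h; exact absurd (Finset.mem_range.2 hjn) h
  have hbound : ∀ n : ℕ, ‖Kn n - K‖ ≤ (b - p) / √(n + 1) := by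
    intro n
    refine ContinuousLinearMap.opNorm_le_bound _ (by positivity) fun g => ?_
    refine le_of_sq_le_sq ?_ (by positivity)
    rw [mul_pow, div_pow, Real.sq_sqrt (by positivity)]
    have hb1 : ∀ᵐ x ∂(mu p b), ((Kn n - K) g) x ^ 2 ≤ (b - p) / (n+1) * ‖g‖^2 := by
      filter_upwards [hKn n g, hK g, Lp.coeFn_sub (Kn n g) (K g), ae_mem p b] with x ⟨y, hy, hyx, hxy, hv⟩ h2 h3 h4
      rw [_root_.sub_apply, h3, Pi.sub_apply, hv, h2, L2_norm_sq]
      have := prim_holder hpb.le (Lp.memLp g) hyx hy.1 h4.2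
      have h0 : 0 ≤ ∫ t, (g t)^2 ∂(mu p b) := integral_nonneg fun t => sq_nonneg _
      calc _ = (prim b g x - prim b g y)^2 := by ring
        _ ≤ _ := this.trans (mul_le_mul_of_nonneg_right hxy h0)
    rw [L2_norm_sq]
    refine (integral_mono_ae (Lp.memLp _).integrable_sq (integrable_const _) hb1).trans (le_of_eq ?_)
    rw [integral_const]
    simp [mu, hpb.le]; ring
  have hlim : Tendsto Kn atTop (𝓝 K) := by
    rw [tendsto_iff_norm_sub_tendsto_zero]
    refine squeeze_zero (fun n => norm_nonneg _) hbound ?_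
    have h1 : Tendsto (fun n : ℕ => √((n:ℝ) + 1)) atTop atTop :=
      Real.tendsto_sqrt_atTop.comp (tendsto_atTop_add_const_right _ _ tendsto_natCast_atTop_atTop)
    exact h1.const_div_atTop _
  refine isCompactOperator_of_tendsto hlim (Eventually.of_forall fun n => ?_)
  have : ∀ s : Finset ℕ, IsCompactOperator (∑ i ∈ s, - (innerSL ℝ (e n i)).smulRight (f n i) :
      Lp ℝ 2 (mu p b) →L[ℝ] Lp ℝ 2 (mu p b)) := by
    intro s
    classical
    induction s using Finset.induction_on with
    | empty => exact isCompactOperator_zero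
    | insert i s hi ih =>
      rw [Finset.sum_insert hi]
      refine IsCompactOperator.add (f := ⇑(-(innerSL ℝ (e n i)).smulRight (f n i))) (IsCompactOperator.neg ?_) ih
      have h1 : IsCompactOperator (innerSL ℝ (e n i)) :=
        isCompactOperator_of_locallyCompactSpace_dom (innerSL ℝ (e n i))
      exact h1.clm_comp ((ContinuousLinearMap.id ℝ ℝ).smulRight (f n i))
  exact this _

theorem hasDerivAt_primitive {b c : ℝ} {k : ℝ → ℝ} (hk : ContinuousOn k (Iio b)) (hc : c < b)
    {x : ℝ} (hx : x < b) : HasDerivAt (fun x => ∫ t in c..x, k t) (k x) x := by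
  have h1 : IntervalIntegrable k volume c x := by
    refine (hk.mono ?_).intervalIntegrable
    intro t ht
    exact lt_of_le_of_lt ht.2 (max_lt hc hx)
  refine intervalIntegral.integral_hasDerivAt_right h1 ?_ (hk.continuousAt (Iio_mem_nhds hx))
  exact hk.stronglyMeasurableAtFilter isOpen_Iio x hx

theorem ac_of_hasDerivAt {b p y : ℝ} {f f' : ℝ → ℝ} (hpy : p ≤ y) (hy : y < b)
    (hf : ∀ x < b, HasDerivAt f (f' x) x) (hc : ContinuousOn f' (Iio b)) :
    AbsolutelyContinuousOnInterval f p y := by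
  have hint : IntervalIntegrable f' volume p y := by
    refine (hc.mono ?_).intervalIntegrable
    intro t ht
    exact lt_of_le_of_lt ht.2 (max_lt (hpy.trans_lt hy) hy)
  have h1 := hint.absolutelyContinuousOnInterval_intervalIntegral (c := p) (by simp)
  have h2 : AbsolutelyContinuousOnInterval (fun _ : ℝ => f p) p y :=
    ((LipschitzWith.const (f p)).lipschitzOnWith (s := uIcc p y)).absolutelyContinuousOnInterval
  have h3 := h2.add h1
  have heq : EqOn f ((fun _ => f p) + fun x => ∫ t in p..x, f' t) (uIcc p y) := by
    intro x hx
    rw [uIcc_of_le hpy] at hx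
    have := intervalIntegral.integral_eq_sub_of_hasDerivAt (a := p) (b := x) (f := f) (f' := f')
      (fun t ht => hf t (by
        rw [uIcc_of_le hx.1] at ht; exact (ht.2.trans hx.2).trans_lt hy))
      ((ii_sub hint (⟨le_rfl, hpy⟩) hx))
    simp [this]
  rw [absolutelyContinuousOnInterval_iff] at h3 ⊢
  intro ε hε
  obtain ⟨d, hd, h⟩ := h3 ε hε
  refine ⟨d, hd, fun E hE hl => ?_⟩
  have := h E hE hl
  refine lt_of_eq_of_lt (Finset.sum_congr rfl fun i hi => ?_) this
  have hm := hE.1 i hi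
  rw [heq hm.1, heq hm.2]

theorem reg_local {p b y h : ℝ} (hpy : p < y) (hyb : y < b) (hh : 0 < h) {g q : ℝ → ℝ}
    (hg : MemLp g 2 (mu p b)) (hq : ContinuousOn q (Iio b))
    (weak : ∀ φ : ℝ → ℝ, MemLp φ 2 (mu p b) → prim b φ p = 0 →
      h^2 * ∫ x, g x * φ x ∂(mu p b) + ∫ x, q x * prim b g x * prim b φ x ∂(mu p b) = 0) :
    ∃ v w : ℝ → ℝ, (∀ x < b, HasDerivAt v (w x) x) ∧
      (∀ x < b, HasDerivAt w (q x * prim b g (max p x) / h^2) x) ∧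
      EqOn (prim b g) v (Icc p y) := by
  have hpb : p < b := hpy.trans hyb
  set U : ℝ → ℝ := fun x => prim b g (max p x) with hU
  have hUc : ContinuousOn U (Iio b) := by
    refine (prim_cont hpb.le hg).comp (continuous_const.max continuous_id).continuousOn ?_
    intro x hx
    exact ⟨le_max_left _ _, max_le hpb.le (le_of_lt hx)⟩
  have hk : ContinuousOn (fun x => q x * U x) (Iio b) := hq.mul hUc
  set G : ℝ → ℝ := fun x => ∫ t in p..x, q t * U t with hG
  have hGd : ∀ x < b, HasDerivAt G (q x * U x) x := fun x hx => hasDerivAt_primitive hk hpb hx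
  have hGc : ContinuousOn G (Iio b) := fun x hx => (hGd x hx).continuousAt.continuousWithinAt
  have hsub : Ioc p y ⊆ Ioc p b := Ioc_subset_Ioc le_rfl hyb.le
  have hrr : (mu p b).restrict (Ioc p y) = volume.restrict (Ioc p y) := by
    rw [mu, Measure.restrict_restrict measurableSet_Ioc, inter_eq_left.2 hsub]
  have hgy : MemLp g 2 (volume.restrict (Ioc p y)) := hrr ▸ hg.restrict (Ioc p y)
  have hGy : MemLp G 2 (volume.restrict (Ioc p y)) := by
    have hc' : ContinuousOn G (Icc p y) := hGc.mono fun x hx => lt_of_le_of_lt hx.2 hyb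
    have : MemLp G 2 (volume.restrict (Icc p y)) := by
      refine (memLp_two_iff_integrable_sq (hc'.aestronglyMeasurable measurableSet_Icc)).2 ?_
      exact (hc'.pow 2).integrableOn_Icc
    have h2 := this.restrict (Ioc p y)
    rwa [Measure.restrict_restrict measurableSet_Ioc, inter_eq_left.2 Ioc_subset_Icc_self] at h2
  set k : ℝ → ℝ := fun x => h^2 * g x - G x with hkdef
  have hkm : MemLp k 2 (volume.restrict (Ioc p y)) := (hgy.const_mul (h^2)).sub hGy
  have hki : Integrable k (volume.restrict (Ioc p y)) := hkm.integrable (by norm_num)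
  set c : ℝ := (∫ x in Ioc p y, k x) / (y - p) with hc
  set φ : ℝ → ℝ := (Ioc p y).indicator (fun x => k x - c) with hφ
  have hkcm : MemLp (fun x => k x - c) 2 (volume.restrict (Ioc p y)) := hkm.sub (memLp_const c)
  have hφm : MemLp φ 2 (mu p b) := by
    rw [hφ, memLp_indicator_iff_restrict measurableSet_Ioc, hrr]
    exact hkcm
  have hint0 : ∫ x in Ioc p y, (k x - c) = 0 := by
    rw [integral_sub hki (integrable_const _), integral_const]
    have : y - p ≠ 0 := by linarith
    simp [hpy.le, hc]
    field_simp
    ring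
  have hΦp : prim b φ p = 0 := by
    rw [prim, intervalIntegral.integral_symm, intervalIntegral.integral_of_le hpb.le, hφ,
      setIntegral_indicator measurableSet_Ioc, inter_eq_right.2 hsub, hint0, neg_zero]
  have hΦy : ∀ x ∈ Icc y b, prim b φ x = 0 := by
    intro x hx
    rw [prim]
    refine intervalIntegral.integral_zero_ae ?_
    rw [uIoc_of_ge hx.2]
    refine ae_of_all _ fun t ht => ?_
    rw [hφ, indicator_of_notMem]
    intro h'; exact absurd h'.2 (not_le.2 (hx.1.trans_lt ht.1))
  have hw := weak φ hφm hΦp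
  have e1 : ∫ x, g x * φ x ∂(mu p b) = ∫ x in Ioc p y, g x * (k x - c) := by
    rw [← hrr, ← integral_indicator measurableSet_Ioc]
    congr 1; ext x
    by_cases hx : x ∈ Ioc p y <;> simp [hφ, hx]
  have e2 : ∫ x, q x * prim b g x * prim b φ x ∂(mu p b) =
      ∫ x in p..y, (q x * U x) * prim b φ x := by
    rw [intervalIntegral.integral_of_le hpy.le, ← hrr, ← integral_indicator measurableSet_Ioc]
    refine integral_congr_ae ?_
    filter_upwards [ae_mem p b] with x hx
    by_cases hx' : x ∈ Ioc p y
    · rw [indicator_of_mem hx', hU]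
      simp only
      rw [max_eq_right hx.1.le]
    · rw [indicator_of_notMem hx', hΦy x ⟨?_, hx.2⟩, mul_zero]
      by_contra hlt
      exact hx' ⟨hx.1, (not_le.1 hlt).le⟩
  have e3 := ibp hpb.le hφm hpy.le hyb.le (ac_of_hasDerivAt hpy.le hyb hGd hk)
    (ae_of_all _ fun x hx => hGd x (hx.2.trans_lt hyb))
  rw [hΦp, hΦy y ⟨le_rfl, hyb.le⟩, mul_zero, mul_zero, sub_zero, zero_sub] at e3
  have e4 : ∫ x in p..y, G x * φ x = ∫ x in Ioc p y, G x * (k x - c) := by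
    rw [intervalIntegral.integral_of_le hpy.le]
    refine setIntegral_congr_fun measurableSet_Ioc fun x hx => ?_
    simp [hφ, indicator_of_mem hx]
  have e5 : ∫ x in Ioc p y, (k x - c)^2 = 0 := by
    have : (fun x => (k x - c)^2) =
        fun x => (h^2 * (g x * (k x - c)) - G x * (k x - c)) - c * (k x - c) := by
      ext x; simp only [hkdef]; ring
    rw [this, integral_sub, integral_sub, integral_const_mul, integral_const_mul, hint0, ← e4, e3,
      ← e1, ← e2]
    · linarith
    · exact (hgy.integrable_mul hkcm).const_mul _
    · exact hGy.integrable_mul hkcm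
    · exact ((hgy.integrable_mul hkcm).const_mul _).sub (hGy.integrable_mul hkcm)
    · exact (hki.sub (integrable_const c)).const_mul _
  have e6 : ∀ᵐ x ∂(volume.restrict (Ioc p y)), g x = (G x + c) / h^2 := by
    rw [integral_eq_zero_iff_of_nonneg (fun x => sq_nonneg _) hkcm.integrable_sq] at e5
    filter_upwards [e5] with x hx
    have : k x - c = 0 := by simpa using hx
    simp only [hkdef] at this
    field_simp; linarith
  have hGc2 : ContinuousOn (fun x => (G x + c) / h^2) (Iio b) :=
    (hGc.add continuousOn_const).div_const _
  refine ⟨fun x => prim b g y + ∫ t in y..x, (G t + c) / h^2, fun x => (G x + c) / h^2, ?_, ?_, ?_⟩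
  · intro x hx
    exact (hasDerivAt_primitive hGc2 hyb hx).const_add _
  · intro x hx
    exact ((hGd x hx).add_const c).div_const _
  · intro x hx
    have h1 := prim_diff hpb.le hg ⟨hpy.le, hyb.le⟩ ⟨hx.1, hx.2.trans hyb.le⟩
    have h2 : ∫ t in y..x, g t = ∫ t in y..x, (G t + c) / h^2 := by
      refine intervalIntegral.integral_congr_ae ?_
      rw [uIoc_of_ge hx.2]
      filter_upwards [(ae_restrict_iff' measurableSet_Ioc).1 e6] with t ht ht2
      exact ht ⟨hx.1.trans_lt ht2.1, ht2.2⟩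
    simp only [← h2]; linarith

theorem regularity {p b h : ℝ} (hpb : p < b) (hh : 0 < h) {g q : ℝ → ℝ}
    (hg : MemLp g 2 (mu p b)) (hq : ContinuousOn q (Iio b))
    (weak : ∀ φ : ℝ → ℝ, MemLp φ 2 (mu p b) → prim b φ p = 0 →
      h^2 * ∫ x, g x * φ x ∂(mu p b) + ∫ x, q x * prim b g x * prim b φ x ∂(mu p b) = 0) :
    ContDiffOn ℝ 2 (prim b g) (Ico p b) ∧
      ∀ x ∈ Ioo p b, -h^2 * deriv (deriv (prim b g)) x + q x * prim b g x = 0 := by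
  constructor
  · intro x hx
    obtain ⟨y, hxy, hyb⟩ := exists_between hx.2
    obtain ⟨v, w, hv, hw, he⟩ := reg_local (hx.1.trans_lt hxy) hyb hh hg hq weak
    have hUc : ContinuousOn (fun x => prim b g (max p x)) (Iio b) := by
      refine (prim_cont hpb.le hg).comp (continuous_const.max continuous_id).continuousOn ?_
      intro x hx
      exact ⟨le_max_left _ _, max_le hpb.le (le_of_lt hx)⟩
    have hw1 : ContDiffOn ℝ 1 w (Iio b) := by
      rw [show (1 : WithTop ℕ∞) = 0 + 1 from rfl, contDiffOn_succ_iff_deriv_of_isOpen isOpen_Iio]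
      refine ⟨fun t ht => (hw t ht).differentiableAt.differentiableWithinAt, by simp, ?_⟩
      rw [contDiffOn_zero]
      refine ((hq.mul hUc).div_const (h^2)).congr fun t ht => (hw t ht).deriv
    have hv2 : ContDiffOn ℝ 2 v (Iio b) := by
      rw [show (2 : WithTop ℕ∞) = 1 + 1 from rfl, contDiffOn_succ_iff_deriv_of_isOpen isOpen_Iio]
      refine ⟨fun t ht => (hv t ht).differentiableAt.differentiableWithinAt, by simp, ?_⟩
      exact hw1.congr fun t ht => (hv t ht).deriv
    have hvx : ContDiffWithinAt ℝ 2 v (Ico p b) x :=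
      (hv2.contDiffAt (Iio_mem_nhds hx.2)).contDiffWithinAt
    refine hvx.congr_of_eventuallyEq ?_ (he ⟨hx.1, hxy.le⟩)
    filter_upwards [self_mem_nhdsWithin, mem_nhdsWithin_of_mem_nhds (Iio_mem_nhds hxy)] with t ht ht2
    exact he ⟨ht.1, le_of_lt ht2⟩
  · intro x hx
    obtain ⟨y, hxy, hyb⟩ := exists_between hx.2
    obtain ⟨v, w, hv, hw, he⟩ := reg_local (hx.1.trans hxy) hyb hh hg hq weak
    have h1 : ∀ t ∈ Ioo p y, deriv (prim b g) t = w t := by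
      intro t ht
      have : prim b g =ᶠ[𝓝 t] v := by
        filter_upwards [Ioo_mem_nhds ht.1 ht.2] with s hs
        exact he ⟨hs.1.le, hs.2.le⟩
      rw [this.deriv_eq, (hv t (ht.2.trans hyb)).deriv]
    have h2 : deriv (prim b g) =ᶠ[𝓝 x] w := by
      filter_upwards [Ioo_mem_nhds hx.1 hxy] with s hs using h1 s hs
    rw [h2.deriv_eq, (hw x hx.2).deriv, max_eq_right hx.1.le]
    field_simp
    ring

theorem inner_L2 {p b : ℝ} (f g : Lp ℝ 2 (mu p b)) :
    inner ℝ f g = ∫ x, f x * g x ∂(mu p b) := by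
  rw [L2.inner_def]
  refine integral_congr_ae (Eventually.of_forall fun x => ?_)
  simp [mul_comm]

theorem mu_Ioo (p b : ℝ) : mu p b = volume.restrict (Ioo p b) :=
  (Measure.restrict_congr_set Ioo_ae_eq_Ioc).symm

theorem ae_mem_Ioo (p b : ℝ) : ∀ᵐ x ∂(mu p b), x ∈ Ioo p b := by
  rw [mu_Ioo]; exact ae_restrict_mem measurableSet_Ioo

theorem aesm_of_cont {p b : ℝ} {f : ℝ → ℝ} (hf : ContinuousOn f (Iio b)) :
    AEStronglyMeasurable f (mu p b) := by
  rw [mu_Ioo]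
  exact (hf.mono (fun x hx => hx.2)).aestronglyMeasurable measurableSet_Ioo

/-- integral over `Ioc p b` of an `L²` function as minus the primitive at `p` -/
theorem prim_p {p b : ℝ} (hpb : p ≤ b) (g : ℝ → ℝ) : prim b g p = - ∫ x, g x ∂(mu p b) := by
  rw [prim, intervalIntegral.integral_symm, intervalIntegral.integral_of_le hpb]
  rfl

theorem exists_bilin {L : Type*} [NormedAddCommGroup L] [InnerProductSpace ℝ L]
    (D D2 : L →L[ℝ] L) (s : ℝ) (H : Submodule ℝ L) :
    ∃ B : H →L[ℝ] H →L[ℝ] ℝ, ∀ x y : H,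
      B x y = s * inner ℝ (x : L) (y : L) + inner ℝ (D2 x) (D y) := by
  refine ⟨LinearMap.mkContinuous₂ (LinearMap.mk₂ ℝ
    (fun x y : H => s * inner ℝ (x : L) (y : L) + inner ℝ (D2 x) (D y)) ?_ ?_ ?_ ?_)
    (|s| + ‖D2‖ * ‖D‖) ?_, ?_⟩
  · intro x y z; simp [inner_add_left]; ring
  · intro c x y; simp [inner_smul_left]; ring
  · intro x y z; simp [inner_add_right]; ring
  · intro c x y; simp [inner_smul_right]; ring
  · intro x y
    simp only [LinearMap.mk₂_apply]
    have h1 : |inner ℝ (x : L) (y : L)| ≤ ‖x‖ * ‖y‖ := abs_real_inner_le_norm _ _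
    have h2 : |inner ℝ (D2 x) (D y)| ≤ (‖D2‖ * ‖x‖) * (‖D‖ * ‖y‖) :=
      (abs_real_inner_le_norm _ _).trans
        (mul_le_mul (D2.le_opNorm _) (D.le_opNorm _) (norm_nonneg _) (by positivity))
    rw [Real.norm_eq_abs]
    calc _ ≤ |s * inner ℝ (x : L) (y : L)| + |inner ℝ (D2 x) (D y)| := abs_add_le _ _
      _ ≤ |s| * (‖x‖ * ‖y‖) + (‖D2‖ * ‖x‖) * (‖D‖ * ‖y‖) := by
        rw [abs_mul]; gcongr
      _ = _ := by ring
  · intro x y; rfl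

theorem SL_eig {p b h : ℝ} (hpb : p < b) (hh : 0 < h) {ρ q : ℝ → ℝ} {ρ0 Cq : ℝ}
    (hρ : ContinuousOn ρ (Iio b)) (hq : ContinuousOn q (Iio b)) (hρ0 : 0 < ρ0)
    (hρ1 : ∀ x ∈ Ico p b, ρ0 ≤ ρ x) (hCq : ∀ x ∈ Ico p b, |q x| ≤ Cq * (ρ x)^2)
    {C : ℝ} (hC0 : 0 ≤ C)
    (hardy : ∀ g, MemLp g 2 (mu p b) → Integrable (fun x => (ρ x * prim b g x)^2) (mu p b) ∧
      ∫ x, (ρ x * prim b g x)^2 ∂(mu p b) ≤ C^2 * ∫ x, (g x)^2 ∂(mu p b))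
    {c θ : ℝ} (hθ : 0 < θ)
    (coer : ∀ g, MemLp g 2 (mu p b) → θ * ∫ x, (g x)^2 ∂(mu p b) ≤
      h^2 * ∫ x, (g x)^2 ∂(mu p b) + ∫ x, (q x + c) * (prim b g x)^2 ∂(mu p b))
    {f : ℝ → ℝ} (hf : ContDiff ℝ 2 f) (hfc : HasCompactSupport f) (hfs : tsupport f ⊆ Ioo p b)
    {E δ : ℝ} (hδ : 0 < δ)
    (quasi : ∫ x, (-h^2 * deriv (deriv f) x + (q x - E) * f x)^2 ∂(mu p b) <
      δ^2 * ∫ x, (f x)^2 ∂(mu p b)) :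
    ∃ κ ∈ Icc (E - δ) (E + δ), ∃ u : ℝ → ℝ, (∃ x ∈ Ico p b, u x ≠ 0) ∧
      ContDiffOn ℝ 2 u (Ico p b) ∧
      (∀ x ∈ Ioo p b, -h^2 * deriv (deriv u) x + q x * u x = κ * u x) ∧
      u p = 0 ∧ IntegrableOn (fun x => (deriv u x)^2 + (ρ x)^2 * (u x)^2) (Ioo p b) := by
  have hρpos : ∀ x ∈ Ico p b, 0 < ρ x := fun x hx => lt_of_lt_of_le hρ0 (hρ1 x hx)
  have hCq0 : 0 ≤ Cq := by
    have h1 := hCq p ⟨le_rfl, hpb⟩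
    have h2 : 0 < ρ p ^ 2 := pow_pos (hρpos p ⟨le_rfl, hpb⟩) 2
    by_contra hn
    push Not at hn
    have := abs_nonneg (q p)
    nlinarith
  -- the operators
  obtain ⟨K, hK⟩ := exists_mulPrim hpb.le (fun _ => 1) aestronglyMeasurable_const (b - p)
    (by linarith) (fun g hg => by simpa using prim_one_bound hpb.le g hg)
  have hK : ∀ g, K g =ᵐ[mu p b] fun x => prim b g x := by simpa using hK
  obtain ⟨D, hD⟩ := exists_mulPrim hpb.le ρ (aesm_of_cont hρ) C hC0 hardy
  set C2 : ℝ := Cq + |c| / ρ0^2 with hC2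
  have hC20 : 0 ≤ C2 := by positivity
  have hw2 : AEStronglyMeasurable (fun x => (q x + c) / ρ x) (mu p b) :=
    ((aesm_of_cont hq).add aestronglyMeasurable_const).div₀ (aesm_of_cont hρ)
  have hw2b : ∀ x ∈ Ico p b, ((q x + c) / ρ x)^2 ≤ C2^2 * (ρ x)^2 := by
    intro x hx
    have h0 := hρpos x hx
    have h1 : |q x + c| ≤ C2 * (ρ x)^2 := by
      calc |q x + c| ≤ |q x| + |c| := abs_add_le _ _
        _ ≤ Cq * (ρ x)^2 + |c| / ρ0^2 * (ρ x)^2 := by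
          have := hCq x hx
          have h3 : ρ0^2 ≤ (ρ x)^2 := pow_le_pow_left₀ hρ0.le (hρ1 x hx) 2
          have h4 : |c| ≤ |c| / ρ0^2 * (ρ x)^2 := by
            rw [div_mul_eq_mul_div, le_div_iff₀ (by positivity)]
            exact mul_le_mul_of_nonneg_left h3 (abs_nonneg _)
          linarith
        _ = _ := by rw [hC2]; ring
    have h2 : |(q x + c) / ρ x| ≤ C2 * ρ x := by
      rw [abs_div, abs_of_pos h0, div_le_iff₀ h0]
      calc _ ≤ _ := h1
        _ = _ := by ring
    calc _ = |(q x + c) / ρ x| ^2 := (sq_abs _).symm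
      _ ≤ (C2 * ρ x)^2 := pow_le_pow_left₀ (abs_nonneg _) h2 2
      _ = _ := by ring
  obtain ⟨D2, hD2⟩ := exists_mulPrim hpb.le (fun x => (q x + c) / ρ x) hw2 (C2 * C)
    (by positivity) (by
      intro g hg
      have hb : ∀ᵐ x ∂(mu p b), ((q x + c) / ρ x * prim b g x)^2 ≤
          C2^2 * (ρ x * prim b g x)^2 := by
        filter_upwards [ae_mem_Ioo p b] with x hx
        have := hw2b x (Ioo_subset_Ico_self hx)
        calc _ = ((q x + c) / ρ x)^2 * (prim b g x)^2 := by ring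
          _ ≤ C2^2 * (ρ x)^2 * (prim b g x)^2 := by gcongr
          _ = _ := by ring
      have hI := ((hardy g hg).1.const_mul (C2^2))
      have hI2 : Integrable (fun x => ((q x + c) / ρ x * prim b g x)^2) (mu p b) := by
        refine hI.mono' ((hw2.mul (prim_aesm hpb.le hg)).pow 2) ?_
        filter_upwards [hb] with x hx
        rw [Real.norm_eq_abs, abs_of_nonneg (sq_nonneg _)]
        exact hx
      refine ⟨hI2, ?_⟩
      calc _ ≤ ∫ x, C2^2 * (ρ x * prim b g x)^2 ∂(mu p b) := integral_mono_ae hI2 hI hb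
        _ = C2^2 * ∫ x, (ρ x * prim b g x)^2 ∂(mu p b) := integral_const_mul _ _
        _ ≤ C2^2 * (C^2 * ∫ x, (g x)^2 ∂(mu p b)) := by gcongr; exact (hardy g hg).2
        _ = _ := by ring)
  have hDD : ∀ g φ : Lp ℝ 2 (mu p b), inner ℝ (D2 g) (D φ) =
      ∫ x, (q x + c) * (prim b g x * prim b φ x) ∂(mu p b) := by
    intro g φ
    rw [inner_L2]
    refine integral_congr_ae ?_
    filter_upwards [hD2 g, hD φ, ae_mem_Ioo p b] with x h1 h2 hx
    rw [h1, h2]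
    have := (hρpos x (Ioo_subset_Ico_self hx)).ne'
    field_simp
  have hDDi : ∀ g φ : Lp ℝ 2 (mu p b),
      Integrable (fun x => (q x + c) * (prim b g x * prim b φ x)) (mu p b) := by
    intro g φ
    refine (MemLp.integrable_mul (Lp.memLp (D2 g)) (Lp.memLp (D φ))).congr ?_
    filter_upwards [hD2 g, hD φ, ae_mem_Ioo p b] with x h1 h2 hx
    simp only [Pi.mul_apply]
    rw [h1, h2]
    have := (hρpos x (Ioo_subset_Ico_self hx)).ne'
    field_simp
  -- the Hilbert space
  set one : Lp ℝ 2 (mu p b) := (memLp_const (1:ℝ)).toLp (fun _ => (1:ℝ)) with hone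
  have hone' : one =ᵐ[mu p b] fun _ => (1:ℝ) := MemLp.coeFn_toLp _
  set H : Submodule ℝ (Lp ℝ 2 (mu p b)) := (Submodule.span ℝ {one})ᗮ with hHdef
  have memH : ∀ g : Lp ℝ 2 (mu p b), g ∈ H ↔ prim b g p = 0 := by
    intro g
    rw [hHdef, Submodule.mem_orthogonal_singleton_iff_inner_right, inner_L2, prim_p hpb.le,
      neg_eq_zero]
    have : ∫ x, one x * g x ∂(mu p b) = ∫ x, g x ∂(mu p b) := by
      refine integral_congr_ae ?_
      filter_upwards [hone'] with x hx
      rw [hx, one_mul]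
    rw [this]
  obtain ⟨B, hB⟩ := exists_bilin D D2 (h^2) H
  have hB' : ∀ g φ : H, B g φ = h^2 * ∫ x, (g : Lp ℝ 2 (mu p b)) x * (φ : Lp ℝ 2 (mu p b)) x ∂(mu p b)
      + ∫ x, (q x + c) * (prim b g x * prim b φ x) ∂(mu p b) := by
    intro g φ; rw [hB, hDD, inner_L2]
  have hcoer : IsCoercive B := by
    refine ⟨θ, hθ, fun g => ?_⟩
    have h1 := coer g (Lp.memLp (g : Lp ℝ 2 (mu p b)))
    rw [hB']
    have h2 : ‖g‖ * ‖g‖ = ∫ x, ((g : Lp ℝ 2 (mu p b)) x)^2 ∂(mu p b) := by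
      rw [← L2_norm_sq, ← pow_two]; rfl
    rw [mul_assoc, h2]
    simpa [pow_two] using h1
  have hsymm : ∀ x y, B x y = B y x := by
    intro x y; rw [hB', hB']
    simp_rw [mul_comm (((y : Lp ℝ 2 (mu p b))) _), mul_comm (prim b ((y : Lp ℝ 2 (mu p b))) _)]
  set J : H →L[ℝ] Lp ℝ 2 (mu p b) := K.comp H.subtypeL with hJ
  have hJc : IsCompactOperator J := (K_compact hpb K hK).comp_clm H.subtypeL
  have hJa : ∀ g : H, J g =ᵐ[mu p b] fun x => prim b g x := fun g => hK g
  -- quasimode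
  have hf1 : ContDiff ℝ 1 (deriv f) := by
    have := (contDiff_succ_iff_deriv (n := 1) (f := f)).1 (by simpa using! hf)
    exact this.2.2
  have hf2 : Continuous (deriv (deriv f)) := hf1.continuous_deriv le_rfl
  have hdf : ∀ x, HasDerivAt f (deriv f x) x := fun x =>
    (hf.differentiable (by norm_num) x).hasDerivAt
  have hddf : ∀ x, HasDerivAt (deriv f) (deriv (deriv f) x) x := fun x =>
    (hf1.differentiable (by norm_num) x).hasDerivAt
  have hzero : ∀ x, x ∉ Ioo p b → f x = 0 := fun x hx =>
    image_eq_zero_of_notMem_tsupport (fun h => hx (hfs h))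
  have hzero' : ∀ x, x ∉ Ioo p b → deriv f x = 0 := fun x hx =>
    image_eq_zero_of_notMem_tsupport (fun h => hx (hfs (tsupport_deriv_subset h)))
  have hfp : f p = 0 := hzero p (by simp)
  have hfb : f b = 0 := hzero b (by simp)
  have hprimf : ∀ x, prim b (deriv f) x = f x := by
    intro x
    rw [prim, intervalIntegral.integral_eq_sub_of_hasDerivAt (fun x _ => hdf x)
      (hf1.continuous.intervalIntegrable _ _), hfb, sub_zero]
  have hfL : MemLp (deriv f) 2 (mu p b) :=
    (hf1.continuous.memLp_of_hasCompactSupport hfc.deriv).restrict _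
  have hqf : Continuous (fun x => (q x + c) * f x) := by
    refine continuous_of_tsupport fun x hx => ?_
    have hx' : x ∈ Ioo p b := hfs (tsupport_mul_subset_right hx)
    exact ((hq.continuousAt (Iio_mem_nhds hx'.2)).add continuousAt_const).mul
      hf.continuous.continuousAt
  set Ff : ℝ → ℝ := fun x => -h^2 * deriv (deriv f) x + (q x + c) * f x with hFf
  have hFc : Continuous Ff := (continuous_const.mul hf2).add hqf
  have hFL : MemLp Ff 2 (mu p b) := by
    refine (hFc.memLp_of_hasCompactSupport ?_).restrict _
    exact (hfc.deriv.deriv.mul_left).add hfc.mul_left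
  set g0L := hfL.toLp (deriv f) with hg0L
  have hg0a : g0L =ᵐ[mu p b] deriv f := hfL.coeFn_toLp
  have hg0p : ∀ x ∈ Icc p b, prim b g0L x = f x := fun x hx => by
    rw [prim_congr hg0a hx, hprimf]
  have hg0H : g0L ∈ H := by
    rw [memH, hg0p p ⟨le_rfl, hpb.le⟩, hfp]
  set g0 : H := ⟨g0L, hg0H⟩ with hg0
  set F := hFL.toLp Ff with hF
  have hFa : F =ᵐ[mu p b] Ff := hFL.coeFn_toLp
  have hJg0 : J g0 =ᵐ[mu p b] f := by
    filter_upwards [hJa g0, ae_mem p b] with x h1 hx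
    rw [h1]; exact hg0p x (Ioc_subset_Icc_self hx)
  have hweak0 : ∀ φ : H, B g0 φ = inner ℝ F (J φ) := by
    intro φ
    have hφ : MemLp (φ : Lp ℝ 2 (mu p b)) 2 (mu p b) := Lp.memLp _
    have h1 := ibp hpb.le hφ hpb.le le_rfl (f := deriv f) (f' := deriv (deriv f))
      (hf1.contDiffOn.absolutelyContinuousOnInterval) (Eventually.of_forall fun x _ => hddf x)
    rw [prim_b, hzero' p (by simp), intervalIntegral.integral_of_le hpb.le,
      intervalIntegral.integral_of_le hpb.le] at h1
    have h1 : ∫ x, deriv f x * (φ : Lp ℝ 2 (mu p b)) x ∂(mu p b) =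
      - ∫ x, deriv (deriv f) x * prim b φ x ∂(mu p b) := by
        simpa [mu] using h1
    rw [hB', inner_L2]
    have e1 : ∫ x, (g0 : Lp ℝ 2 (mu p b)) x * (φ : Lp ℝ 2 (mu p b)) x ∂(mu p b) =
        ∫ x, deriv f x * (φ : Lp ℝ 2 (mu p b)) x ∂(mu p b) := by
      refine integral_congr_ae ?_
      filter_upwards [hg0a] with x hx
      show g0L x * _ = _
      rw [hx]
    have hpφ : MemLp (prim b φ) 2 (mu p b) := (Lp.memLp (K φ)).ae_eq (hK φ)
    have hd2L : MemLp (deriv (deriv f)) 2 (mu p b) :=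
      (hf2.memLp_of_hasCompactSupport hfc.deriv.deriv).restrict _
    have e2 : ∫ x, F x * (J φ) x ∂(mu p b) =
        ∫ x, (-h^2 * (deriv (deriv f) x * prim b φ x) + (q x + c) * (prim b g0 x * prim b φ x))
          ∂(mu p b) := by
      refine integral_congr_ae ?_
      filter_upwards [hFa, hJa φ, ae_mem p b] with x h1 h2 hx
      rw [h1, h2]
      have : prim b g0 x = f x := hg0p x (Ioc_subset_Icc_self hx)
      rw [this, hFf]; ring
    have hi1 : Integrable (fun x => -h^2 * (deriv (deriv f) x * prim b φ x)) (mu p b) :=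
      (hd2L.integrable_mul hpφ).const_mul _
    rw [e2, integral_add hi1 (hDDi _ _), e1, h1,
      integral_const_mul]
    ring
  have hquasi : ‖F - (E + c) • J g0‖ < δ * ‖J g0‖ := by
    have h1 : ‖F - (E + c) • J g0‖^2 < (δ * ‖J g0‖)^2 := by
      rw [mul_pow, L2_norm_sq, L2_norm_sq]
      have e1 : ∫ x, ((J g0) x)^2 ∂(mu p b) = ∫ x, (f x)^2 ∂(mu p b) := by
        refine integral_congr_ae ?_
        filter_upwards [hJg0] with x hx
        rw [hx]
      rw [e1]
      refine lt_of_eq_of_lt ?_ quasi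
      refine integral_congr_ae ?_
      filter_upwards [hJg0, hFa, Lp.coeFn_sub F ((E + c) • J g0), Lp.coeFn_smul (E + c) (J g0)]
        with x h1 h2 h3 h4
      rw [h3, Pi.sub_apply, h4, Pi.smul_apply, h1, h2, hFf]
      simp only [smul_eq_mul]; ring
    exact lt_of_pow_lt_pow_left₀ 2 (by positivity) h1
  obtain ⟨g, κ', hκ, hne, hg⟩ := abstract_eig B hcoer hsymm J hJc g0 F hweak0 (E + c) δ hquasi
  have hgL : MemLp (g : Lp ℝ 2 (mu p b)) 2 (mu p b) := Lp.memLp _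
  set κ := κ' - c with hκdef
  have hreg := regularity (q := fun x => q x - κ) hpb hh hgL (hq.sub continuousOn_const) (by
    intro φ hφ hφ0
    set φL := hφ.toLp φ with hφL
    have hφa : φL =ᵐ[mu p b] φ := hφ.coeFn_toLp
    have hφp : ∀ x ∈ Icc p b, prim b φL x = prim b φ x := fun x hx => prim_congr hφa hx
    have hφH : φL ∈ H := by rw [memH, hφp p ⟨le_rfl, hpb.le⟩, hφ0]
    have h1 := hg ⟨φL, hφH⟩
    rw [hB', inner_L2] at h1
    have e1 : ∫ x, (g : Lp ℝ 2 (mu p b)) x * φL x ∂(mu p b) =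
        ∫ x, (g : Lp ℝ 2 (mu p b)) x * φ x ∂(mu p b) := by
      refine integral_congr_ae ?_
      filter_upwards [hφa] with x hx
      rw [hx]
    have hpφ : MemLp (prim b φL) 2 (mu p b) := (Lp.memLp (K φL)).ae_eq (hK φL)
    have hpg : MemLp (prim b g) 2 (mu p b) := (Lp.memLp (K g)).ae_eq (hK g)
    have e2 : ∫ x, (J g) x * (J ⟨φL, hφH⟩) x ∂(mu p b) =
        ∫ x, prim b g x * prim b φL x ∂(mu p b) := by
      refine integral_congr_ae ?_
      filter_upwards [hJa g, hJa ⟨φL, hφH⟩] with x h1 h2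
      rw [h1, h2]
    have e3 : ∫ x, (q x - κ) * prim b g x * prim b φ x ∂(mu p b) =
        ∫ x, ((q x + c) * (prim b g x * prim b φL x) - κ' * (prim b g x * prim b φL x))
          ∂(mu p b) := by
      refine integral_congr_ae ?_
      filter_upwards [ae_mem p b] with x hx
      rw [hφp x (Ioc_subset_Icc_self hx), hκdef]; ring
    have hi1 : Integrable (fun x => κ' * (prim b g x * prim b φL x)) (mu p b) :=
      (hpg.integrable_mul hpφ).const_mul _
    rw [e3, integral_sub (hDDi _ _) hi1, integral_const_mul,
      ← e1, ← e2]
    simp only at h1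
    linarith)
  refine ⟨κ, ?_, prim b g, ?_, hreg.1, ?_, (memH g).1 g.2, ?_⟩
  · rw [abs_le] at hκ
    constructor <;> linarith [hκ.1, hκ.2]
  · by_contra hn
    push Not at hn
    apply hne
    rw [Lp.eq_zero_iff_ae_eq_zero]
    filter_upwards [hJa g, ae_mem_Ioo p b] with x h1 hx
    rw [h1]; exact hn x (Ioo_subset_Ico_self hx)
  · intro x hx
    have := hreg.2 x hx
    linarith
  · have e : IntegrableOn (fun x => ((g : Lp ℝ 2 (mu p b)) x)^2 + (ρ x * prim b g x)^2) (Ioo p b) := by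
      rw [IntegrableOn, ← mu_Ioo]
      exact hgL.integrable_sq.add (hardy g hgL).1
    refine e.congr ?_
    filter_upwards [ae_restrict_mem measurableSet_Ioo, ae_restrict_of_ae (prim_deriv hpb.le hgL)]
      with x hx hx2
    rw [(hx2 (Ioo_subset_Icc_self hx)).deriv]
    ring

theorem hardy_y {p b : ℝ} (hpb : p < b) {R R' : ℝ → ℝ} (hR : ∀ x < b, HasDerivAt R (R' x) x)
    (hR'c : ContinuousOn R' (Iio b)) (hpos : ∀ x ∈ Ico p b, 0 < R x) {β C1 : ℝ} (hβ : 0 < β)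
    (ineq : ∀ x ∈ Ico p b, 2 * (β * R x)^2 - C1 ≤ β * R' x)
    {g : ℝ → ℝ} (hg : MemLp g 2 (mu p b)) {y : ℝ} (hpy : p < y) (hy : y < b) :
    β^2 * ∫ x in p..y, (R x * prim b g x)^2 ≤
      (∫ x in p..y, (g x)^2) + C1 * (∫ x in p..y, (prim b g x)^2) + β * R y * (prim b g y)^2 := by
  have hRc : ContinuousOn R (Iio b) := fun x hx => (hR x hx).continuousAt.continuousWithinAt
  have hsub : Icc p y ⊆ Iio b := fun x hx => lt_of_le_of_lt hx.2 hy
  have hRi : ContinuousOn R (Icc p y) := hRc.mono hsub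
  have hR'i : ContinuousOn R' (Icc p y) := hR'c.mono hsub
  have hsub2 : Icc p y ⊆ Icc p b := Icc_subset_Icc_right hy.le
  have hui : ContinuousOn (prim b g) (Icc p y) := (prim_cont hpb.le hg).mono hsub2
  have acR : AbsolutelyContinuousOnInterval R p y := ac_of_hasDerivAt hpy.le hy hR hR'c
  have acu : AbsolutelyContinuousOnInterval (prim b g) p y :=
    (prim_ac hpb.le hg).mono (by rw [uIcc_of_le hpy.le, uIcc_of_le hpb.le]; exact hsub2)
  have key := ibp hpb.le hg hpy.le hy.le (f := fun x => R x * prim b g x)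
    (f' := fun x => R' x * prim b g x + R x * g x) (acR.mul acu) (by
      filter_upwards [prim_deriv hpb.le hg] with x hx hx2
      exact (hR x (hsub hx2)).mul (hx (hsub2 hx2)))
  have hgi : IntervalIntegrable g volume p y :=
    ii_sub (memLp_intervalIntegrable hpb.le hg) ⟨le_rfl, hpb.le⟩ ⟨hpy.le, hy.le⟩
  have hg2 : IntervalIntegrable (fun x => (g x)^2) volume p y := by
    rw [intervalIntegrable_iff_integrableOn_Ioc_of_le hpy.le]
    exact (show IntegrableOn (fun x => (g x)^2) (Ioc p b) volume from hg.integrable_sq).mono_set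
      (Ioc_subset_Ioc_right hy.le)
  have ci : ∀ {f : ℝ → ℝ}, ContinuousOn f (Icc p y) → IntervalIntegrable f volume p y := by
    intro f hf
    exact (by rwa [uIcc_of_le hpy.le] : ContinuousOn f (uIcc p y)).intervalIntegrable
  have i1 : IntervalIntegrable (fun x => R' x * (prim b g x)^2) volume p y :=
    ci (hR'i.mul (hui.pow 2))
  have i2 : IntervalIntegrable (fun x => R x * prim b g x * g x) volume p y :=
    hgi.continuousOn_mul (by rw [uIcc_of_le hpy.le]; exact hRi.mul hui)
  have i3 : IntervalIntegrable (fun x => (R x * prim b g x)^2) volume p y :=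
    ci ((hRi.mul hui).pow 2)
  have i4 : IntervalIntegrable (fun x => (prim b g x)^2) volume p y := ci (hui.pow 2)
  have e1 : ∫ x in p..y, (R' x * prim b g x + R x * g x) * prim b g x =
      (∫ x in p..y, R' x * (prim b g x)^2) + ∫ x in p..y, R x * prim b g x * g x := by
    rw [← intervalIntegral.integral_add i1 i2]
    congr 1; ext x; ring
  rw [e1] at key
  have mono : ∫ x in p..y, (β^2 * (R x * prim b g x)^2) ≤
      ∫ x in p..y, ((g x)^2 + C1 * (prim b g x)^2 + (2 * β) * (R x * prim b g x * g x)
        + β * (R' x * (prim b g x)^2)) := by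
    refine intervalIntegral.integral_mono_on hpy.le (i3.const_mul _)
      (((hg2.add (i4.const_mul _)).add (i2.const_mul _)).add (i1.const_mul _)) ?_
    intro x hx
    have h1 := ineq x ⟨hx.1, hsub hx⟩
    have h2 := mul_le_mul_of_nonneg_right h1 (sq_nonneg (prim b g x))
    have h3 := sq_nonneg (g x + β * R x * prim b g x)
    nlinarith
  rw [intervalIntegral.integral_add ((hg2.add (i4.const_mul _)).add (i2.const_mul _))
    (i1.const_mul _), intervalIntegral.integral_add (hg2.add (i4.const_mul _)) (i2.const_mul _),
    intervalIntegral.integral_add hg2 (i4.const_mul _)] at mono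
  simp only [intervalIntegral.integral_const_mul] at mono
  have h5 : 0 ≤ β * (R p * prim b g p * prim b g p) := by
    have := hpos p ⟨le_rfl, hpb⟩
    rw [mul_assoc]
    have := mul_self_nonneg (prim b g p)
    positivity
  nlinarith

theorem hardy_abs {p b : ℝ} (hpb : p < b) {R R' : ℝ → ℝ} (hR : ∀ x < b, HasDerivAt R (R' x) x)
    (hR'c : ContinuousOn R' (Iio b)) (hpos : ∀ x ∈ Ico p b, 0 < R x) {β C1 K : ℝ} (hβ : 0 < β)
    (hC1 : 0 ≤ C1)
    (ineq : ∀ x ∈ Ico p b, 2 * (β * R x)^2 - C1 ≤ β * R' x)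
    (bd : ∀ᶠ x in 𝓝[<] b, (b - x) * R x ≤ K)
    (g : ℝ → ℝ) (hg : MemLp g 2 (mu p b)) :
    Integrable (fun x => (R x * prim b g x)^2) (mu p b) ∧
    β^2 * ∫ x, (R x * prim b g x)^2 ∂(mu p b) ≤
      (∫ x, (g x)^2 ∂(mu p b)) + C1 * (∫ x, (prim b g x)^2 ∂(mu p b)) := by
  obtain ⟨ys, -, hys, hyt⟩ := exists_seq_strictMono_tendsto' hpb
  have hyt' : Tendsto ys atTop (𝓝[<] b) :=
    tendsto_nhdsWithin_iff.2 ⟨hyt, Eventually.of_forall fun n => (hys n).2⟩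
  have hg2 : IntegrableOn (fun x => (g x)^2) (Ioc p b) := hg.integrable_sq
  have hu2 : IntegrableOn (fun x => (prim b g x)^2) (Ioc p b) := by
    simpa using! (prim_one_bound hpb.le g hg).1
  have hmono : ∀ {f : ℝ → ℝ}, IntegrableOn f (Ioc p b) → (∀ x, 0 ≤ f x) → ∀ n,
      ∫ x in p..(ys n), f x ≤ ∫ x in Ioc p b, f x := by
    intro f hf h0 n
    rw [intervalIntegral.integral_of_le (hys n).1.le]
    exact setIntegral_mono_set hf (Eventually.of_forall h0)
      (Ioc_subset_Ioc_right (hys n).2.le).eventuallyLE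
  have hconv : ∀ {f : ℝ → ℝ}, IntegrableOn f (Ioc p b) →
      Tendsto (fun n => ∫ x in p..(ys n), f x) atTop (𝓝 (∫ x in Ioc p b, f x)) := by
    intro f hf
    have h1 : ContinuousOn (fun y => ∫ x in p..y, f x) (uIcc p b) :=
      intervalIntegral.continuousOn_primitive_interval'
        ((intervalIntegrable_iff_integrableOn_Ioc_of_le hpb.le).2 hf) left_mem_uIcc
    have h2 := h1 b right_mem_uIcc
    rw [← intervalIntegral.integral_of_le hpb.le]
    refine h2.tendsto.comp (tendsto_nhdsWithin_iff.2 ⟨hyt, Eventually.of_forall fun n => ?_⟩)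
    rw [uIcc_of_le hpb.le]; exact Ioo_subset_Icc_self (hys n)
  have htail : ∀ n, ∫ x in Ioc (ys n) b, (g x)^2 =
      (∫ x in Ioc p b, (g x)^2) - ∫ x in p..(ys n), (g x)^2 := by
    intro n
    have hi := (intervalIntegrable_iff_integrableOn_Ioc_of_le hpb.le).2 hg2
    have := intervalIntegral.integral_add_adjacent_intervals
      (ii_sub hi ⟨le_rfl, hpb.le⟩ (Ioo_subset_Icc_self (hys n)))
      (ii_sub hi (Ioo_subset_Icc_self (hys n)) ⟨hpb.le, le_rfl⟩)
    rw [← intervalIntegral.integral_of_le hpb.le, ← intervalIntegral.integral_of_le (hys n).2.le]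
    linarith
  have hbound : ∀ᶠ n in atTop, β^2 * ∫ x in p..(ys n), (R x * prim b g x)^2 ≤
      (∫ x in Ioc p b, (g x)^2) + C1 * (∫ x in Ioc p b, (prim b g x)^2) +
      β * K * ((∫ x in Ioc p b, (g x)^2) - ∫ x in p..(ys n), (g x)^2) := by
    filter_upwards [hyt'.eventually bd] with n hn
    have h1 := hardy_y hpb hR hR'c hpos hβ ineq hg (hys n).1 (hys n).2
    have h2 := hmono hg2 (fun x => sq_nonneg _) n
    have h3 := hmono hu2 (fun x => sq_nonneg _) n
    have h4 := prim_bound hpb.le hg (Ioo_subset_Icc_self (hys n))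
    rw [htail] at h4
    have h5 : β * R (ys n) * (prim b g (ys n))^2 ≤
        β * K * ((∫ x in Ioc p b, (g x)^2) - ∫ x in p..(ys n), (g x)^2) := by
      have hRp := hpos _ (Ioo_subset_Ico_self (hys n))
      calc _ ≤ β * R (ys n) * ((b - ys n) *
            ((∫ x in Ioc p b, (g x)^2) - ∫ x in p..(ys n), (g x)^2)) := by gcongr
        _ = β * ((b - ys n) * R (ys n)) *
            ((∫ x in Ioc p b, (g x)^2) - ∫ x in p..(ys n), (g x)^2) := by ring
        _ ≤ _ := by
          have : 0 ≤ (∫ x in Ioc p b, (g x)^2) - ∫ x in p..(ys n), (g x)^2 := by linarith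
          gcongr
    have h6 := mul_le_mul_of_nonneg_left h3 hC1
    linarith
  have hlim : Tendsto (fun n => (∫ x in Ioc p b, (g x)^2) + C1 * (∫ x in Ioc p b, (prim b g x)^2) +
      β * K * ((∫ x in Ioc p b, (g x)^2) - ∫ x in p..(ys n), (g x)^2)) atTop
      (𝓝 ((∫ x in Ioc p b, (g x)^2) + C1 * (∫ x in Ioc p b, (prim b g x)^2))) := by
    have := ((hconv hg2).const_sub (∫ x in Ioc p b, (g x)^2)).const_mul (β * K)
    simpa using this.const_add ((∫ x in Ioc p b, (g x)^2) + C1 * (∫ x in Ioc p b, (prim b g x)^2))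
  have hint : IntegrableOn (fun x => (R x * prim b g x)^2) (Ioc p b) := by
    set A := (∫ x in Ioc p b, (g x)^2) + C1 * (∫ x in Ioc p b, (prim b g x)^2)
    refine integrableOn_Ioc_of_intervalIntegral_norm_bounded_right (I := (A + 1) / β^2)
      (b := ys) (l := atTop) ?_ hyt ?_
    · intro n
      refine ContinuousOn.integrableOn_Icc (a := p) (b := ys n) ?_ |>.mono_set Ioc_subset_Icc_self
      refine ContinuousOn.pow (ContinuousOn.mul ?_ ?_) 2
      · exact fun x hx => (hR x (lt_of_le_of_lt hx.2 (hys n).2)).continuousAt.continuousWithinAt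
      · exact (prim_cont hpb.le hg).mono (Icc_subset_Icc_right (hys n).2.le)
    · filter_upwards [hbound, hlim.eventually (gt_mem_nhds (lt_add_one A))] with n h1 h2
      rw [le_div_iff₀ (by positivity)]
      rw [intervalIntegral.integral_of_le (hys n).1.le] at h1
      have : ∀ x, ‖(R x * prim b g x)^2‖ = (R x * prim b g x)^2 := fun x => by
        rw [Real.norm_eq_abs, abs_of_nonneg (sq_nonneg _)]
      simp_rw [this]
      linarith
  refine ⟨hint, ?_⟩
  exact le_of_tendsto_of_tendsto ((hconv hint).const_mul (β^2)) hlim hbound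

def Bd (r0 : ℝ) (f : ℝ → ℝ) : Prop := ∃ C, ∀ r, r0 ≤ r → |f r| ≤ C

theorem Bd.const {r0 : ℝ} (c : ℝ) : Bd r0 (fun _ => c) := ⟨|c|, fun _ _ => le_rfl⟩

theorem Bd.add {r0 : ℝ} {f g : ℝ → ℝ} (hf : Bd r0 f) (hg : Bd r0 g) :
    Bd r0 (fun r => f r + g r) := by
  obtain ⟨C, hC⟩ := hf
  obtain ⟨D, hD⟩ := hg
  exact ⟨C + D, fun r hr => (abs_add_le _ _).trans (add_le_add (hC r hr) (hD r hr))⟩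

theorem Bd.mul {r0 : ℝ} {f g : ℝ → ℝ} (hf : Bd r0 f) (hg : Bd r0 g) :
    Bd r0 (fun r => f r * g r) := by
  obtain ⟨C, hC⟩ := hf
  obtain ⟨D, hD⟩ := hg
  refine ⟨C * D, fun r hr => ?_⟩
  rw [abs_mul]
  exact mul_le_mul (hC r hr) (hD r hr) (abs_nonneg _) ((abs_nonneg _).trans (hC r hr))

theorem Bd.congr {r0 : ℝ} {f g : ℝ → ℝ} (hf : Bd r0 f) (h : ∀ r, r0 ≤ r → g r = f r) : Bd r0 g := by
  obtain ⟨C, hC⟩ := hf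
  exact ⟨C, fun r hr => by rw [h r hr]; exact hC r hr⟩

theorem bd_P (a : ℝ) {r0 : ℝ} (h0 : 0 < r0) : Bd r0 (fun r => r^2/(r^2+a^2)) := by
  refine ⟨1, fun r hr => ?_⟩
  have : 0 < r := h0.trans_le hr
  rw [abs_of_nonneg (by positivity), div_le_one (by positivity)]
  nlinarith [sq_nonneg a]

theorem S_le (a : ℝ) {r : ℝ} (hr : 0 < r) : r/(r^2+a^2) ≤ 1/r := by
  rw [div_le_div_iff₀ (by positivity) hr]
  nlinarith [sq_nonneg a]

theorem bd_S (a : ℝ) {r0 : ℝ} (h0 : 0 < r0) : Bd r0 (fun r => r/(r^2+a^2)) := by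
  refine ⟨1/r0, fun r hr => ?_⟩
  have : 0 < r := h0.trans_le hr
  rw [abs_of_nonneg (by positivity)]
  exact (S_le a this).trans (one_div_le_one_div_of_le h0 hr)

theorem bd_Q (a : ℝ) {r0 : ℝ} (h0 : 0 < r0) : Bd r0 (fun r => 1/(r^2+a^2)) := by
  refine ⟨1/r0^2, fun r hr => ?_⟩
  have : 0 < r := h0.trans_le hr
  rw [abs_of_nonneg (by positivity)]
  apply one_div_le_one_div_of_le (by positivity)
  nlinarith [sq_nonneg a]

theorem bd_sig (M l a : ℝ) (hl : 0 < l) {r0 : ℝ} (h0 : 0 < r0) : Bd r0 (Vsig M l a) := by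
  refine (((bd_Q a h0).add ((bd_P a h0).mul (Bd.const (1/l^2)))).add
    ((Bd.const (-2*M)).mul ((bd_S a h0).mul (bd_Q a h0)))).congr ?_
  intro r hr
  have : 0 < r := h0.trans_le hr
  have : r^2 + a^2 ≠ 0 := by positivity
  unfold Vsig Dm
  field_simp
  ring

theorem bd_mass (M l a α : ℝ) (hl : 0 < l) {r0 : ℝ} (h0 : 0 < r0) :
    Bd r0 (fun r => Vmass M l a α r - (2-α)/l^4 * r^2) := by
  refine ((Bd.const ((2-α)/l^2)).mul (((bd_P a h0).mul (Bd.const (1 - a^2/l^2))).add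
    ((Bd.const (-2*M)).mul ((bd_S a h0).mul (bd_P a h0))))).congr ?_
  intro r hr
  have : 0 < r := h0.trans_le hr
  have : r^2 + a^2 ≠ 0 := by positivity
  unfold Vmass Dm
  field_simp
  ring

theorem bd_junk (M l a α : ℝ) (hl : 0 < l) {r0 : ℝ} (h0 : 0 < r0) :
    Bd r0 (Vjunk M l a α) := by
  have hP := bd_P a h0
  have hS := bd_S a h0
  have hQ := bd_Q a h0
  refine ((bd_sig M l a hl h0).mul (((((hP.mul (Bd.const (-3 + 3*(1+a^2/l^2) - 2*a^2/l^2))).add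
    ((Bd.const (6*M)).mul (hP.mul hS))).add ((Bd.const (-4*M)).mul hS)).add
    ((Bd.const (a^2)).mul hQ)).add (Bd.const (-(α/l^2) * Th α * a^2)))).congr ?_
  intro r hr
  have : 0 < r := h0.trans_le hr
  have : r^2 + a^2 ≠ 0 := by positivity
  unfold Vjunk Vsig
  have hD : Dm M l a r = (1 + r^2/l^2)*(r^2+a^2) - 2*M*r := rfl
  have e : 3*r^2*(Dm M l a r)^2/(r^2+a^2)^4 =
      Dm M l a r/(r^2+a^2)^2 * (3 * r^2/(r^2+a^2) * (1 + r^2/l^2 - 2*M*(r/(r^2+a^2)))) := by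
    rw [show (Dm M l a r)^2 = Dm M l a r * ((1 + r^2/l^2)*(r^2+a^2) - 2*M*r) by rw [pow_two]; rfl]
    field_simp
  rw [e]
  generalize Dm M l a r = X
  generalize Th α = T
  field_simp
  ring

theorem hardy_bd (M l a : ℝ) (hM : 0 < M) (hl : 0 < l) {b : ℝ} {R : ℝ → ℝ}
    (hRderiv : ∀ x < b, HasDerivAt R (Dm M l a (R x) / ((R x)^2 + a^2)) x)
    (hRtop : Tendsto R (𝓝[<] b) atTop) :
    ∀ᶠ x in 𝓝[<] b, (b - x) * R x ≤ 2 * l^2 := by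
  obtain ⟨y, hyb, hy⟩ := (mem_nhdsLT_iff_exists_Ioo_subset).1
    (hRtop.eventually (eventually_ge_atTop (2*M)))
  have hge : ∀ x ∈ Ioo y b, 2 * M ≤ R x := fun x hx => hy hx
  have hpos : ∀ x ∈ Ioo y b, 0 < R x := fun x hx => by linarith [hge x hx]
  have hd : ∀ x ∈ Ioo y b, HasDerivAt (fun x => (R x)⁻¹ + 1/(2*l^2) * x)
      (-(Dm M l a (R x) / ((R x)^2 + a^2)) / (R x)^2 + 1/(2*l^2) * 1) x := fun x hx =>
    ((hRderiv x hx.2).inv (hpos x hx).ne').add ((hasDerivAt_id x).const_mul _)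
  have hanti : AntitoneOn (fun x => (R x)⁻¹ + 1/(2*l^2) * x) (Ioo y b) := by
    refine antitoneOn_of_deriv_nonpos (convex_Ioo _ _)
      (fun x hx => (hd x hx).continuousAt.continuousWithinAt) ?_ ?_
    · rw [interior_Ioo]
      exact fun x hx => (hd x hx).differentiableAt.differentiableWithinAt
    · rw [interior_Ioo]
      intro x hx
      rw [(hd x hx).deriv]
      have h0 := hpos x hx
      have h1 := hge x hx
      have h2 : Dm M l a (R x) / ((R x)^2 + a^2) = 1 + (R x)^2/l^2 - 2*M*(R x/((R x)^2+a^2)) := by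
        unfold Dm; field_simp
      have h3 : 2*M*(R x/((R x)^2+a^2)) ≤ 1 := by
        calc _ ≤ 2*M*(1/R x) := mul_le_mul_of_nonneg_left (S_le a h0) (by positivity)
          _ = 2*M/R x := by ring
          _ ≤ 1 := (div_le_one h0).2 h1
      have h4 : 1/(2*l^2) * (R x)^2 ≤ Dm M l a (R x) / ((R x)^2 + a^2) := by
        rw [h2]
        have : 1/(2*l^2) * (R x)^2 ≤ (R x)^2/l^2 := by
          rw [div_mul_eq_mul_div, div_le_div_iff₀ (by positivity) (by positivity)]
          have : 0 ≤ R x ^2 * l^2 := by positivity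
          nlinarith
        linarith
      have h5 : 1/(2*l^2) ≤ (Dm M l a (R x) / ((R x)^2 + a^2)) / (R x)^2 := by
        rw [le_div_iff₀ (by positivity)]; exact h4
      rw [neg_div]; linarith
  have hlim : Tendsto (fun x => (R x)⁻¹ + 1/(2*l^2) * x) (𝓝[<] b) (𝓝 (0 + 1/(2*l^2) * b)) :=
    (tendsto_inv_atTop_zero.comp hRtop).add
      (((continuous_const.mul continuous_id).tendsto b).mono_left nhdsWithin_le_nhds)
  filter_upwards [Ioo_mem_nhdsLT hyb] with x hx
  have h1 : 0 + 1/(2*l^2) * b ≤ (R x)⁻¹ + 1/(2*l^2) * x := by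
    refine le_of_tendsto hlim ?_
    filter_upwards [Ioo_mem_nhdsLT hx.2] with z hz
    exact hanti hx ⟨hx.1.trans hz.1, hz.2⟩ hz.1.le
  have h0 := hpos x hx
  have h2 : 1/(2*l^2) * (b - x) ≤ (R x)⁻¹ := by linarith
  have h3 := mul_le_mul_of_nonneg_right h2 h0.le
  rw [inv_mul_cancel₀ h0.ne'] at h3
  have h4 : (2*l^2) * (1/(2*l^2) * (b - x) * R x) ≤ (2*l^2) * 1 := by gcongr
  have h5 : (2*l^2) * (1/(2*l^2) * (b - x) * R x) = (b-x) * R x := by field_simp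
  linarith

theorem cont_sig (M l a : ℝ) : ContinuousOn (Vsig M l a) (Ioi 0) := by
  intro r hr
  have hr : 0 < r := hr
  have : (r^2 + a^2)^2 ≠ 0 := by positivity
  refine ContinuousAt.continuousWithinAt ?_
  unfold Vsig Dm
  fun_prop (disch := assumption)

theorem cont_jm (M l a α : ℝ) :
    ContinuousOn (fun r => Vjunk M l a α r + Vmass M l a α r) (Ioi 0) := by
  intro r hr
  have hr : 0 < r := hr
  have h2 : (r^2 + a^2)^2 ≠ 0 := by positivity
  have h3 : (r^2 + a^2)^3 ≠ 0 := by positivity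
  have h4 : (r^2 + a^2)^4 ≠ 0 := by positivity
  refine ContinuousAt.continuousWithinAt ?_
  unfold Vjunk Vmass Dm
  fun_prop (disch := assumption)

theorem cont_comp_mul {p b : ℝ} {w f : ℝ → ℝ} (hw : ContinuousOn w (Iio b)) (hf : Continuous f)
    (hfs : tsupport f ⊆ Ioo p b) : Continuous (fun x => w x * f x) := by
  refine continuous_of_tsupport fun x hx => ?_
  have hx' : x ∈ Ioo p b := hfs (tsupport_mul_subset_right hx)
  exact (hw.continuousAt (Iio_mem_nhds hx'.2)).mul hf.continuousAt

/-- a point in the well where the potential equals `E`, and a bump function there -/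
theorem exists_bump {p b E δ : ℝ} {v : ℝ → ℝ} (hv : ContinuousOn v (Iio b)) (hpb : p < b)
    (hp : E < v p) (hlt : ∀ᶠ x in 𝓝[<] b, v x < E) (hδ : 0 < δ) :
    ∃ f : ℝ → ℝ, ContDiff ℝ 2 f ∧ HasCompactSupport f ∧ tsupport f ⊆ Ioo p b ∧
      0 < ∫ x, (f x)^2 ∂(mu p b) ∧ ∀ x, f x ≠ 0 → |v x - E| ≤ δ/2 := by
  obtain ⟨x1, hx1, hx1'⟩ := (hlt.and (Ioo_mem_nhdsLT hpb)).exists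
  have hc : ContinuousOn v (Icc p x1) := hv.mono fun x hx => lt_of_le_of_lt hx.2 hx1'.2
  obtain ⟨x0, hx0, hE⟩ := intermediate_value_Icc' hx1'.1.le hc ⟨hx1.le, hp.le⟩
  have hx0p : p < x0 := lt_of_le_of_ne hx0.1 (by rintro rfl; linarith)
  have hx0b : x0 < b := lt_of_le_of_lt hx0.2 hx1'.2
  have hcx : ContinuousAt v x0 := hv.continuousAt (Iio_mem_nhds hx0b)
  have h1 : ∀ᶠ x in 𝓝 x0, |v x - E| < δ/2 := by
    have := Metric.tendsto_nhds.1 hcx (δ/2) (by positivity)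
    simpa [Real.dist_eq, hE] using this
  obtain ⟨ε, hε, hball⟩ := Metric.mem_nhds_iff.1 (h1.and (Ioo_mem_nhds hx0p hx0b))
  let f : ContDiffBump x0 := ⟨ε/4, ε/2, by positivity, by linarith⟩
  have hts : tsupport f ⊆ Metric.ball x0 ε := by
    rw [f.tsupport_eq]
    exact Metric.closedBall_subset_ball (show ε/2 < ε by linarith)
  have hfs : tsupport f ⊆ Ioo p b := fun x hx => (hball (hts hx)).2
  refine ⟨f, f.contDiff, f.hasCompactSupport, hfs, ?_, ?_⟩
  · have e : ∫ x, (f x)^2 ∂(mu p b) = ∫ x, (f x)^2 := by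
      refine setIntegral_eq_integral_of_forall_compl_eq_zero fun x hx => ?_
      have : f x = 0 := image_eq_zero_of_notMem_tsupport
        (fun h => hx (Ioo_subset_Ioc_self (hfs h)))
      rw [this]; norm_num
    rw [e]
    refine Continuous.integral_pos_of_hasCompactSupport_nonneg_nonzero (x := x0)
      (f.continuous.pow 2) ?_ (fun x => sq_nonneg _) ?_
    · have := f.hasCompactSupport.mul_right (f' := f)
      simpa [pow_two] using! this
    · have : f x0 = 1 := f.one_of_mem_closedBall (by simp [f]; positivity)
      rw [this]; norm_num
  · intro x hx
    exact (hball (hts (subset_tsupport _ hx))).1.le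

theorem Vsig_lt (M l a : ℝ) (hM : 0 < M) (hl : 0 < l) {E : ℝ} (hE : 1/l^2 < E) :
    ∀ᶠ r in atTop, Vsig M l a r < E := by
  have h1 : Tendsto (fun r : ℝ => 1/r^2) atTop (𝓝 0) := by
    simpa using (tendsto_pow_neg_atTop (𝕜 := ℝ) (n := 2) (by norm_num))
  filter_upwards [h1.eventually (gt_mem_nhds (sub_pos.2 hE)), eventually_gt_atTop 0] with r h2 hr
  have h3 : Vsig M l a r ≤ 1/r^2 + 1/l^2 := by
    have e : Vsig M l a r = 1/(r^2+a^2) + (r^2/(r^2+a^2))*(1/l^2)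
        - 2*M*(r/(r^2+a^2))*(1/(r^2+a^2)) := by
      unfold Vsig Dm
      field_simp
    have h4 : 1/(r^2+a^2) ≤ 1/r^2 :=
      one_div_le_one_div_of_le (by positivity) (by nlinarith [sq_nonneg a])
    have h5 : (r^2/(r^2+a^2))*(1/l^2) ≤ 1 * (1/l^2) := by
      refine mul_le_mul_of_nonneg_right ?_ (by positivity)
      rw [div_le_one (by positivity)]; nlinarith [sq_nonneg a]
    have h6 : 0 ≤ 2*M*(r/(r^2+a^2))*(1/(r^2+a^2)) := by positivity
    linarith
  linarith

set_option maxHeartbeats 1000000 in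
theorem main_thm (M l a α : ℝ) (hM : 0 < M) (hl : 0 < l) (hα : α < 9/4)
    (rmax : ℝ) (hrmax : 0 < rmax) (R : ℝ → ℝ) (p b : ℝ) (hpb : p < b)
    (hRge : ∀ x ∈ Ico p b, rmax ≤ R x) (hRpos : ∀ x < b, 0 < R x)
    (hRderiv : ∀ x < b, HasDerivAt R (Dm M l a (R x) / ((R x)^2 + a^2)) x)
    (hRtop : Tendsto R (𝓝[<] b) atTop)
    (E δ : ℝ) (hE1 : 1/l^2 < E) (hE2 : E < Vsig M l a (R p)) (hδ : 0 < δ) :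
    ∃ H₀ > 0, ∀ h ∈ Ioc 0 H₀, ∃ κ ∈ Icc (E - δ) (E + δ),
      ∃ u : ℝ → ℝ, (∃ x ∈ Ico p b, u x ≠ 0) ∧
      ContDiffOn ℝ 2 u (Ico p b) ∧
      (∀ x ∈ Ioo p b, -h^2 * deriv (deriv u) x + Vfull M l a α R h x * u x = κ * u x) ∧
      u p = 0 ∧ IntegrableOn (fun x => (deriv u x)^2 + (R x)^2 * (u x)^2) (Ioo p b) := by
  have hRc : ContinuousOn R (Iio b) := fun x hx => (hRderiv x hx).continuousAt.continuousWithinAt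
  have hmaps : MapsTo R (Iio b) (Ioi 0) := fun x hx => hRpos x hx
  have hvc : ContinuousOn (fun x => Vsig M l a (R x)) (Iio b) := (cont_sig M l a).comp hRc hmaps
  have hjc : ContinuousOn (fun x => Vjunk M l a α (R x) + Vmass M l a α (R x)) (Iio b) :=
    (cont_jm M l a α).comp hRc hmaps
  have hR'c : ContinuousOn (fun x => Dm M l a (R x) / ((R x)^2 + a^2)) (Iio b) := by
    unfold Dm
    refine ContinuousOn.div (by fun_prop) (by fun_prop) fun x hx => ?_
    have := hRpos x hx
    positivity
  obtain ⟨f, hf, hfc, hfs, hN, hfE⟩ := exists_bump hvc hpb hE2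
    (hRtop.eventually (Vsig_lt M l a hM hl hE1)) hδ
  set N := ∫ x, (f x)^2 ∂(mu p b) with hNdef
  set G : ℝ → ℝ := fun x => -deriv (deriv f) x +
    (Vjunk M l a α (R x) + Vmass M l a α (R x)) * f x with hG
  have hf1 : ContDiff ℝ 1 (deriv f) := by
    have := (contDiff_succ_iff_deriv (n := 1) (f := f)).1 (by simpa using! hf)
    exact this.2.2
  have hf2 : Continuous (deriv (deriv f)) := hf1.continuous_deriv le_rfl
  have hGc : Continuous G := hf2.neg.add (cont_comp_mul hjc hf.continuous hfs)
  have hGL : MemLp G 2 (mu p b) := by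
    refine (hGc.memLp_of_hasCompactSupport ?_).restrict _
    exact (hfc.deriv.deriv.neg).add hfc.mul_left
  have hfL : MemLp f 2 (mu p b) := (hf.continuous.memLp_of_hasCompactSupport hfc).restrict _
  set A := ∫ x, (G x)^2 ∂(mu p b) with hAdef
  have hA : 0 ≤ A := integral_nonneg fun x => sq_nonneg _
  -- potential bounds
  obtain ⟨Cs, hCs⟩ := bd_sig M l a hl hrmax
  obtain ⟨Cj, hCj⟩ := bd_junk M l a α hl hrmax
  obtain ⟨Cm, hCm⟩ := bd_mass M l a α hl hrmax
  set β : ℝ := 1/(2*l^2) with hβ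
  have hβ0 : 0 < β := by positivity
  set C1 : ℝ := 2*M*β/rmax with hC1
  have hC10 : 0 ≤ C1 := by positivity
  have hardy := hardy_abs hpb hRderiv hR'c (fun x hx => hRpos x hx.2) hβ0 hC10 (by
    intro x hx
    have h0 := hRpos x hx.2
    have e : Dm M l a (R x) / ((R x)^2 + a^2) = 1 + (R x)^2/l^2 - 2*M*(R x/((R x)^2+a^2)) := by
      unfold Dm; field_simp
    have h1 : R x/((R x)^2+a^2) ≤ 1/rmax :=
      (S_le a h0).trans (one_div_le_one_div_of_le hrmax (hRge x hx))
    have h2 : 2*M*β*(R x/((R x)^2+a^2)) ≤ C1 := by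
      calc _ ≤ 2*M*β*(1/rmax) := mul_le_mul_of_nonneg_left h1 (by positivity)
        _ = C1 := by rw [hC1]; ring
    have h3 : 2 * (β * R x)^2 = β * ((R x)^2/l^2) := by rw [hβ]; field_simp
    rw [e, h3]
    have : β * (1 + (R x)^2/l^2 - 2*M*(R x/((R x)^2+a^2))) = β + β * ((R x)^2/l^2) -
      2*M*β*(R x/((R x)^2+a^2)) := by ring
    rw [this]; linarith) (hardy_bd M l a hM hl hRderiv hRtop)
  refine ⟨min 1 (δ^2 * N / (8 * (A + 1))), lt_min one_pos (by positivity), ?_⟩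
  rintro h ⟨hh, hh2⟩
  have hh1 : h ≤ 1 := hh2.trans (min_le_left _ _)
  have hhA : h ≤ δ^2 * N / (8 * (A + 1)) := hh2.trans (min_le_right _ _)
  have hVc : ContinuousOn (Vfull M l a α R h) (Iio b) := hvc.add (continuousOn_const.mul hjc)
  set γ : ℝ := (2-α)/l^4 with hγ
  set θ : ℝ := min 1 (9 - 4*α) with hθdef
  have hθ0 : 0 < θ := lt_min one_pos (by linarith)
  have hθ1 : θ ≤ 1 := min_le_left _ _
  have hγθ : -(1-θ) * β^2 ≤ γ := by
    have h1 : -(1-θ)/4 ≤ 2 - α := by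
      rcases le_total α 2 with h | h
      · linarith
      · have : θ ≤ 9 - 4*α := min_le_right _ _
        linarith
    have h2 : β^2 = 1/4/l^4 := by rw [hβ]; field_simp; norm_num
    rw [hγ, h2, div_eq_mul_one_div (2-α)]
    calc _ = -(1-θ)/4 * (1/l^4) := by ring
      _ ≤ _ := by gcongr
  set c0 := Cs + h^2*Cj + h^2*Cm with hc0
  -- potential minus leading term is bounded
  have hdiff : ∀ x ∈ Ico p b, |Vfull M l a α R h x - h^2 * γ * (R x)^2| ≤ c0 := by
    intro x hx
    have h1 := hCs _ (hRge x hx)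
    have h2 := hCj _ (hRge x hx)
    have h3 := hCm _ (hRge x hx)
    have e : Vfull M l a α R h x - h^2 * γ * (R x)^2 = Vsig M l a (R x) +
      h^2 * Vjunk M l a α (R x) + h^2 * (Vmass M l a α (R x) - (2-α)/l^4 * (R x)^2) := by
      unfold Vfull; ring
    rw [e]
    refine (abs_add_three _ _ _).trans ?_
    rw [abs_mul, abs_mul, abs_of_pos (pow_pos hh 2)]
    have hh2 : 0 ≤ h^2 := sq_nonneg h
    have := mul_le_mul_of_nonneg_left h2 hh2
    have := mul_le_mul_of_nonneg_left h3 hh2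
    simp only [hc0]
    linarith
  have hc00 : 0 ≤ c0 := (abs_nonneg _).trans (hdiff p ⟨le_rfl, hpb⟩)
  set Cq := c0 / rmax^2 + h^2 * |γ| with hCq
  have hCqb : ∀ x ∈ Ico p b, |Vfull M l a α R h x| ≤ Cq * (R x)^2 := by
    intro x hx
    have h1 := hdiff x hx
    have h2 : rmax^2 ≤ (R x)^2 := pow_le_pow_left₀ hrmax.le (hRge x hx) 2
    have h3 : c0 ≤ c0 / rmax^2 * (R x)^2 := by
      rw [div_mul_eq_mul_div, le_div_iff₀ (by positivity)]
      exact mul_le_mul_of_nonneg_left h2 hc00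
    have h4 : |h^2 * γ * (R x)^2| = h^2 * |γ| * (R x)^2 := by
      rw [abs_mul, abs_mul, abs_of_nonneg (sq_nonneg h), abs_of_nonneg (sq_nonneg (R x))]
    calc _ = |(Vfull M l a α R h x - h^2 * γ * (R x)^2) + h^2 * γ * (R x)^2| := by ring_nf
      _ ≤ _ := abs_add_le _ _
      _ ≤ c0 / rmax^2 * (R x)^2 + h^2 * |γ| * (R x)^2 := by rw [h4]; linarith
      _ = _ := by rw [hCq]; ring
  have hCq0 : 0 ≤ Cq := by positivity
  -- the Hardy constant
  set CH : ℝ := √((1 + C1 * (b-p)^2)/β^2) with hCH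
  refine SL_eig hpb hh hRc hVc hrmax hRge hCqb (C := CH) (Real.sqrt_nonneg _) ?_
    (c := c0 + h^2 * C1) (θ := h^2 * θ) (by positivity) ?_ hf hfc hfs hδ ?_
  · intro g hg
    refine ⟨(hardy g hg).1, ?_⟩
    have h1 := (hardy g hg).2
    have h2 := (prim_one_bound hpb.le g hg).2
    simp only [one_mul] at h2
    rw [hCH, Real.sq_sqrt (by positivity), div_mul_eq_mul_div, le_div_iff₀ (by positivity)]
    have := mul_le_mul_of_nonneg_left h2 hC10
    linarith
  · intro g hg
    have h1 := (hardy g hg).2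
    have hiR := (hardy g hg).1
    have hiu : Integrable (fun x => (prim b g x)^2) (mu p b) := by
      simpa using (prim_one_bound hpb.le g hg).1
    set c := c0 + h^2 * C1 with hc
    have hlow : Integrable (fun x => -(h^2 * ((1-θ) * β^2)) * (R x * prim b g x)^2 +
        h^2 * C1 * (prim b g x)^2) (mu p b) := (hiR.const_mul _).add (hiu.const_mul _)
    have hiq : Integrable (fun x => (Vfull M l a α R h x + c) * (prim b g x)^2) (mu p b) := by
      refine ((hiR.const_mul Cq).add (hiu.const_mul |c|)).mono'
        (((aesm_of_cont hVc).add aestronglyMeasurable_const).mul ((prim_aesm hpb.le hg).pow 2)) ?_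
      filter_upwards [ae_mem_Ioo p b] with x hx
      rw [Real.norm_eq_abs, abs_mul, abs_of_nonneg (sq_nonneg (prim b g x))]
      simp only [Pi.add_apply]
      have h2 := hCqb x (Ioo_subset_Ico_self hx)
      have h3 : |Vfull M l a α R h x + c| ≤ Cq * (R x)^2 + |c| :=
        (abs_add_le _ _).trans (by linarith)
      calc _ ≤ (Cq * (R x)^2 + |c|) * (prim b g x)^2 := by gcongr
        _ = _ := by ring
    have hmono := integral_mono_ae hlow hiq (by
      filter_upwards [ae_mem_Ioo p b] with x hx
      have h2 := (abs_le.1 (hdiff x (Ioo_subset_Ico_self hx))).1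
      have h3 : -(h^2 * ((1-θ) * β^2)) * (R x)^2 ≤ h^2 * γ * (R x)^2 := by
        have h4 := mul_le_mul_of_nonneg_left hγθ (mul_nonneg (sq_nonneg h) (sq_nonneg (R x)))
        nlinarith
      have h5 : -(h^2 * ((1-θ) * β^2)) * (R x)^2 + h^2 * C1 ≤ Vfull M l a α R h x + c := by
        rw [hc]; linarith
      have h6 := mul_le_mul_of_nonneg_right h5 (sq_nonneg (prim b g x))
      calc _ = (-(h^2 * ((1-θ) * β^2)) * (R x)^2 + h^2 * C1) * (prim b g x)^2 := by ring
        _ ≤ _ := h6)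
    rw [integral_add (hiR.const_mul _) (hiu.const_mul _), integral_const_mul,
      integral_const_mul] at hmono
    set X := ∫ x, (g x)^2 ∂(mu p b)
    set Y := ∫ x, (prim b g x)^2 ∂(mu p b)
    set Z := ∫ x, (R x * prim b g x)^2 ∂(mu p b)
    have hY : 0 ≤ Y := integral_nonneg fun x => sq_nonneg _
    have h7 : h^2 * (1-θ) * (β^2 * Z) ≤ h^2 * (1-θ) * (X + C1 * Y) :=
      mul_le_mul_of_nonneg_left h1 (mul_nonneg (sq_nonneg h) (by linarith))
    have h8 : 0 ≤ h^2 * θ * (C1 * Y) := by positivity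
    linarith
  · have hmono : ∫ x, (-h^2 * deriv (deriv f) x + (Vfull M l a α R h x - E) * f x)^2 ∂(mu p b) ≤
        ∫ x, (δ^2/2 * (f x)^2 + 2*h^4 * (G x)^2) ∂(mu p b) := by
      refine integral_mono_of_nonneg (Eventually.of_forall fun x => sq_nonneg _)
        ((hfL.integrable_sq.const_mul _).add (hGL.integrable_sq.const_mul _))
        (Eventually.of_forall fun x => ?_)
      have e : -h^2 * deriv (deriv f) x + (Vfull M l a α R h x - E) * f x =
          (Vsig M l a (R x) - E) * f x + h^2 * G x := by
        rw [hG]; unfold Vfull; ring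
      have h1 : ((Vsig M l a (R x) - E) * f x)^2 ≤ (δ/2)^2 * (f x)^2 := by
        by_cases hx : f x = 0
        · simp [hx]
        · have := hfE x hx
          rw [mul_pow]
          refine mul_le_mul_of_nonneg_right ?_ (sq_nonneg _)
          rw [← sq_abs (Vsig M l a (R x) - E)]
          exact pow_le_pow_left₀ (abs_nonneg _) this 2
      simp only [e]
      nlinarith [sq_nonneg ((Vsig M l a (R x) - E) * f x - h^2 * G x)]
    refine lt_of_le_of_lt hmono ?_
    rw [integral_add (hfL.integrable_sq.const_mul _) (hGL.integrable_sq.const_mul _),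
      integral_const_mul, integral_const_mul]
    rw [← hNdef, ← hAdef]
    have h4 : h^4 ≤ h := by
      have : h^4 ≤ h^1 := pow_le_pow_of_le_one hh.le hh1 (by norm_num)
      simpa using this
    have h5 : h * (8 * (A+1)) ≤ δ^2 * N := (le_div_iff₀ (by positivity)).1 hhA
    have h6 : h^4 * A ≤ h * A := mul_le_mul_of_nonneg_right h4 hA
    have h7 : 0 < δ^2 * N := by positivity
    linarith

/-- existence of eigenvalues of the linear Dirichlet problem in [E−δ, E+δ]
for all sufficiently small h. -/
theorem statement1 (M l a α : ℝ) (hM : 0 < M) (hl : 0 < l) (ha : |a| < l) (hα : α < 9/4)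
    (rp : ℝ) (hrp : 0 < rp) (hrp0 : Dm M l a rp = 0)
    (hrppos : ∀ r, rp < r → 0 < Dm M l a r)
    (rmax : ℝ) (hrmax : rp < rmax)
    (hmax : ∀ r ∈ Set.Ici rp, r ≠ rmax → Vsig M l a r < Vsig M l a rmax)
    (R : ℝ → ℝ) (hRmono : StrictMonoOn R (Set.Iio (π/2)))
    (hRim : R '' Set.Iio (π/2) = Set.Ioi rp)
    (hRderiv : ∀ x < π/2, HasDerivAt R (Dm M l a (R x) / ((R x)^2 + a^2)) x)
    (hRtop : Filter.Tendsto R (nhdsWithin (π/2) (Set.Iio (π/2))) Filter.atTop)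
    (xmax : ℝ) (hxmax : xmax < π/2) (hRxmax : R xmax = rmax)
    (E δ : ℝ) (hE : E ∈ Set.Ioo (1/l^2) (Vsig M l a rmax)) (hδ : 0 < δ)
    (hEδ : Set.Icc (E - δ) (E + δ) ⊆ Set.Ioo (1/l^2) (Vsig M l a rmax)) :
    ∃ H₀ > 0, ∀ h ∈ Set.Ioc 0 H₀, ∃ κ ∈ Set.Icc (E - δ) (E + δ),
      IsDirichletEigenvalue M l a α R xmax h κ := by
  have hRgt : ∀ x < π/2, rp < R x := fun x hx => by
    have : R x ∈ R '' Set.Iio (π/2) := ⟨x, hx, rfl⟩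
    rw [hRim] at this
    exact this
  obtain ⟨H₀, hH, hmain⟩ := main_thm M l a α hM hl hα rmax (hrp.trans hrmax) R xmax (π/2) hxmax
    (fun x hx => by
      rw [← hRxmax]
      exact hRmono.monotoneOn hxmax hx.2 hx.1)
    (fun x hx => hrp.trans (hRgt x hx)) hRderiv hRtop E δ hE.1 (by rw [hRxmax]; exact hE.2) hδ
  refine ⟨H₀, hH, fun h hh => ?_⟩
  obtain ⟨κ, hκ, u, hu⟩ := hmain h hh
  exact ⟨κ, hκ, u, hu⟩
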